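/- arXiv:1612.07314 — 4 statements merged into one kernel-verified Lean document; each statement's English description precedes it below -/
import Mathlib

section
/- Dold's theorem on nullhomotopic equivariant selfmaps, for spheres: Let G be a nontrivial finite group acting continuously and freely on S^n. Then no continuous G-equivariant map f : S^n → S^n (i.e. f(g • x) = g • f(x) for all g, x) is nullhomotopic (homotopic to a constant map). -/
namespace OrderedChain

open Finset Uniformity

section Chains

variable (R : Type*) [CommRing R] {X Y : Type*}

/-- The chain given by a single ordered tuple of points. -/
noncomputable abbrev tuple (l : List X) : List X →₀ R := Finsupp.single l 1

/-- Prepending a vertex to every tuple of a chain. -/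
noncomputable def cone (x : X) : (List X →₀ R) →ₗ[R] (List X →₀ R) :=
  Finsupp.lmapDomain R R (List.cons x)

/-- The map induced on ordered chains by a map of vertices. -/
noncomputable def push (u : X → Y) : (List X →₀ R) →ₗ[R] (List Y →₀ R) :=
  Finsupp.lmapDomain R R (List.map u)

/-- The boundary of a tuple in the augmented ordered chain complex. -/
noncomputable def tupleBoundary : List X → (List X →₀ R)
  | [] => 0
  | x :: l => tuple R l - cone R x (tupleBoundary l)

/-- The boundary operator of the augmented ordered chain complex on `X`; the empty tuple spans
degree `-1`. -/
noncomputable def boundary : (List X →₀ R) →ₗ[R] (List X →₀ R) :=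
  Finsupp.linearCombination R (tupleBoundary R)

/-- The prism on a tuple, interpolating between its images under `u` and `v`. -/
noncomputable def tuplePrism (u v : X → Y) : List X → (List Y →₀ R)
  | [] => 0
  | x :: l => cone R (u x) (tuple R (v x :: l.map v)) - cone R (u x) (tuplePrism u v l)

/-- The prism operator, a chain homotopy between `push R u` and `push R v`. -/
noncomputable def prism (u v : X → Y) : (List X →₀ R) →ₗ[R] (List Y →₀ R) :=
  Finsupp.linearCombination R (tuplePrism R u v)

variable {R}

theorem hom_ext_tuple {M : Type*} [AddCommGroup M] [Module R M] {φ ψ : (List X →₀ R) →ₗ[R] M}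
    (h : ∀ l, φ (tuple R l) = ψ (tuple R l)) : φ = ψ :=
  Finsupp.lhom_ext' fun l => LinearMap.ext_ring (h l)

@[simp]
theorem cone_tuple (x : X) (l : List X) : cone R x (tuple R l) = tuple R (x :: l) := by
  simp [cone, tuple]

@[simp]
theorem push_tuple (u : X → Y) (l : List X) :
    push R u (tuple R l) = tuple R (l.map u) := by
  simp [push, tuple]

@[simp]
theorem boundary_nil : boundary R (tuple R ([] : List X)) = 0 := by
  simp [boundary, tupleBoundary]

@[simp]
theorem boundary_cons (x : X) (l : List X) :
    boundary R (tuple R (x :: l)) = tuple R l - cone R x (boundary R (tuple R l)) := by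
  simp [boundary, tupleBoundary]

@[simp]
theorem prism_nil (u v : X → Y) : prism R u v (tuple R []) = 0 := by
  simp [prism, tuplePrism]

@[simp]
theorem prism_cons (u v : X → Y) (x : X) (l : List X) :
    prism R u v (tuple R (x :: l)) =
      tuple R (u x :: v x :: l.map v) - cone R (u x) (prism R u v (tuple R l)) := by
  simp [prism, tuplePrism]

theorem push_cone (u : X → Y) (x : X) (c : List X →₀ R) :
    push R u (cone R x c) = cone R (u x) (push R u c) := by
  refine LinearMap.congr_fun (f := push R u ∘ₗ cone R x) (g := cone R (u x) ∘ₗ push R u)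
    (hom_ext_tuple fun l => ?_) c
  simp only [LinearMap.comp_apply, cone_tuple, push_tuple, List.map_cons]

theorem boundary_cone (x : X) (c : List X →₀ R) :
    boundary R (cone R x c) = c - cone R x (boundary R c) := by
  refine LinearMap.congr_fun (f := boundary R ∘ₗ cone R x)
    (g := LinearMap.id - cone R x ∘ₗ boundary R) (hom_ext_tuple fun l => ?_) c
  simp only [LinearMap.comp_apply, cone_tuple, boundary_cons, LinearMap.sub_apply,
    LinearMap.id_apply]

theorem boundary_boundary (c : List X →₀ R) : boundary R (boundary R c) = 0 := by
  refine LinearMap.congr_fun (f := boundary R ∘ₗ boundary R) (g := 0)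
    (hom_ext_tuple fun l => ?_) c
  induction l with
  | nil => simp only [LinearMap.comp_apply, boundary_nil, map_zero, LinearMap.zero_apply]
  | cons x l ih =>
    simp only [LinearMap.comp_apply, LinearMap.zero_apply] at ih ⊢
    rw [boundary_cons, map_sub, boundary_cone, ih, map_zero, sub_zero, sub_self]

theorem boundary_push (u : X → Y) (c : List X →₀ R) :
    boundary R (push R u c) = push R u (boundary R c) := by
  refine LinearMap.congr_fun (f := boundary R ∘ₗ push R u) (g := push R u ∘ₗ boundary R)
    (hom_ext_tuple fun l => ?_) c
  induction l with
  | nil => simp only [LinearMap.comp_apply, boundary_nil, push_tuple, List.map_nil, map_zero]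
  | cons x l ih =>
    simp only [LinearMap.comp_apply, push_tuple, List.map_cons, boundary_cons, map_sub,
      push_cone] at ih ⊢
    rw [ih]

theorem prism_cone (u v : X → Y) (x : X) (c : List X →₀ R) :
    prism R u v (cone R x c) =
      cone R (u x) (cone R (v x) (push R v c)) - cone R (u x) (prism R u v c) := by
  refine LinearMap.congr_fun (f := prism R u v ∘ₗ cone R x)
    (g := cone R (u x) ∘ₗ cone R (v x) ∘ₗ push R v - cone R (u x) ∘ₗ prism R u v)
    (hom_ext_tuple fun l => ?_) c
  simp only [LinearMap.comp_apply, cone_tuple, prism_cons, LinearMap.sub_apply, push_tuple]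

theorem boundary_prism (u v : X → Y) (c : List X →₀ R) :
    boundary R (prism R u v c) = push R v c - push R u c - prism R u v (boundary R c) := by
  refine LinearMap.congr_fun (f := boundary R ∘ₗ prism R u v)
    (g := push R v - push R u - prism R u v ∘ₗ boundary R) (hom_ext_tuple fun l => ?_) c
  induction l with
  | nil => simp [-Finsupp.single_eq_same]
  | cons x l ih =>
    simp only [LinearMap.comp_apply, LinearMap.sub_apply] at ih ⊢
    have hv : boundary R (tuple R (l.map v)) = push R v (boundary R (tuple R l)) := by
      rw [← push_tuple, boundary_push]
    simp only [prism_cons, map_sub, boundary_cons, boundary_cone, prism_cone, ih, push_tuple,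
      List.map_cons, cone_tuple, hv]
    abel

/-- The chains all of whose tuples have entries that are pairwise `V`-close. -/
def small (R : Type*) [CommRing R] (V : Set (X × X)) : Submodule R (List X →₀ R) :=
  Finsupp.supported R R {l | ∀ a ∈ l, ∀ b ∈ l, (a, b) ∈ V}

theorem tuple_mem_small {V : Set (X × X)} {l : List X} (h : ∀ a ∈ l, ∀ b ∈ l, (a, b) ∈ V) :
    tuple R l ∈ small R V :=
  Finsupp.single_mem_supported R _ h

/-- A linear map sends small chains into a submodule as soon as it does so for small tuples. -/
theorem map_mem_of_mem_small {M : Type*} [AddCommGroup M] [Module R M] {V : Set (X × X)}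
    {φ : (List X →₀ R) →ₗ[R] M} {N : Submodule R M}
    (h : ∀ l, (∀ a ∈ l, ∀ b ∈ l, (a, b) ∈ V) → φ (tuple R l) ∈ N)
    {c : List X →₀ R} (hc : c ∈ small R V) : φ c ∈ N := by
  rw [small, Finsupp.supported_eq_span_single] at hc
  have : Submodule.span R ((fun i => Finsupp.single i (1 : R)) ''
      {l : List X | ∀ a ∈ l, ∀ b ∈ l, (a, b) ∈ V}) ≤ N.comap φ := by
    rw [Submodule.span_le]
    rintro _ ⟨l, hl, rfl⟩
    exact h l hl
  exact this hc

theorem push_mem_small {V : Set (X × X)} {W : Set (Y × Y)} {u : X → Y}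
    (h : ∀ a b, (a, b) ∈ V → (u a, u b) ∈ W) {c : List X →₀ R} (hc : c ∈ small R V) :
    push R u c ∈ small R W := by
  refine map_mem_of_mem_small (fun l hl => ?_) hc
  rw [push_tuple]
  refine tuple_mem_small fun a ha b hb => ?_
  obtain ⟨x, hx, rfl⟩ := List.mem_map.1 ha
  obtain ⟨y, hy, rfl⟩ := List.mem_map.1 hb
  exact h x y (hl x hx y hy)

theorem prism_tuple_mem_supported (u v : X → Y) (l : List X) :
    prism R u v (tuple R l) ∈
      Finsupp.supported R R {l' : List Y | ∀ a ∈ l', ∃ x ∈ l, a = u x ∨ a = v x} := by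
  induction l with
  | nil => rw [prism_nil]; exact Submodule.zero_mem _
  | cons x l ih =>
    rw [prism_cons]
    refine Submodule.sub_mem _ (Finsupp.single_mem_supported R _ ?_) ?_
    · simp only [Set.mem_ofPred_eq, List.mem_cons, List.mem_map]
      rintro a (rfl | rfl | ⟨y, hy, rfl⟩)
      · exact ⟨x, by simp, by simp⟩
      · exact ⟨x, by simp, by simp⟩
      · exact ⟨y, by simp [hy], by simp⟩
    · have := Submodule.mem_map_of_mem (f := cone R (u x)) ih
      rw [cone, Finsupp.lmapDomain_supported] at this
      refine Finsupp.supported_mono ?_ this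
      rintro _ ⟨l', hl', rfl⟩ a ha
      rcases List.mem_cons.1 ha with rfl | ha
      · exact ⟨x, by simp, by simp⟩
      · obtain ⟨y, hy, h⟩ := hl' a ha
        exact ⟨y, by simp [hy], h⟩

theorem prism_mem_small {V : Set (X × X)} {W : Set (Y × Y)} {u v : X → Y}
    (h : ∀ a b, (a, b) ∈ V → (u a, u b) ∈ W ∧ (u a, v b) ∈ W ∧ (v a, u b) ∈ W ∧ (v a, v b) ∈ W)
    {c : List X →₀ R} (hc : c ∈ small R V) : prism R u v c ∈ small R W := by
  refine map_mem_of_mem_small (fun l hl => ?_) hc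
  refine Finsupp.supported_mono (fun l' hl' a ha b hb => ?_) (prism_tuple_mem_supported u v l)
  obtain ⟨x, hx, hax⟩ := hl' a ha
  obtain ⟨y, hy, hby⟩ := hl' b hb
  obtain ⟨h₁, h₂, h₃, h₄⟩ := h x y (hl x hx y hy)
  rcases hax with rfl | rfl <;> rcases hby with rfl | rfl <;> assumption

end Chains

section Resolution

variable {A : Type*} [Ring A]

/-- The operators `s - 1` (even index) and `1 + s + ⋯ + s ^ (m - 1)` (odd index) of the periodic
resolution of a cyclic group of order `m` with generator `s`. -/
def resol (s : A) (m i : ℕ) : A :=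
  if Even i then s - 1 else ∑ j ∈ range m, s ^ j

theorem resol_add_two (s : A) (m i : ℕ) : resol s m (i + 2) = resol s m i := by
  simp [resol, Nat.even_add]

theorem resol_mul_resol {s : A} {m : ℕ} (hs : s ^ m = 1) (i : ℕ) :
    resol s m (i + 1) * resol s m i = 0 := by
  rcases Nat.even_or_odd i with hi | hi
  · have h1 : ¬ Even (i + 1) := by simpa [Nat.even_add_one] using hi
    rw [resol, resol, if_neg h1, if_pos hi, geom_sum_mul, hs, sub_self]
  · have h1 : Even (i + 1) := hi.add_one
    rw [resol, resol, if_pos h1, if_neg (Nat.not_even_iff_odd.2 hi), mul_geom_sum, hs, sub_self]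

theorem commute_resol {a s : A} (h : Commute a s) (m i : ℕ) : Commute a (resol s m i) := by
  unfold resol
  split_ifs
  · exact h.sub_right (Commute.one_right a)
  · exact Commute.sum_right _ _ _ fun j _ => h.pow_right j

end Resolution

section Cyclic

variable (R : Type*) [CommRing R] {X : Type*} (T : X → X) (m : ℕ)

/-- The operators of the periodic resolution acting on ordered chains through `T`. -/
noncomputable def tau (i : ℕ) : Module.End R (List X →₀ R) :=
  resol (push R T : Module.End R (List X →₀ R)) m i

variable {R T m}

theorem push_pow (j : ℕ) :
    (push R T : Module.End R (List X →₀ R)) ^ j = push R T^[j] := by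
  refine hom_ext_tuple fun l => ?_
  induction j with
  | zero => simp [push_tuple]
  | succ j ih =>
    rw [pow_succ', Module.End.mul_apply, ih, push_tuple, push_tuple, push_tuple, List.map_map,
      Function.iterate_succ']

theorem push_pow_eq_one (hT : T^[m] = id) : (push R T : Module.End R (List X →₀ R)) ^ m = 1 := by
  rw [push_pow, hT]
  exact hom_ext_tuple fun l => by simp

theorem tau_tau (hT : T^[m] = id) (i : ℕ) (c : List X →₀ R) :
    tau R T m (i + 1) (tau R T m i c) = 0 :=
  LinearMap.congr_fun
    (resol_mul_resol (A := Module.End R (List X →₀ R)) (push_pow_eq_one (R := R) hT) i) c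

theorem tau_apply_even {i : ℕ} (hi : Even i) (c : List X →₀ R) :
    tau R T m i c = push R T c - c := by
  simp [tau, resol, hi]

theorem tau_apply_odd {i : ℕ} (hi : ¬ Even i) (c : List X →₀ R) :
    tau R T m i c = ∑ j ∈ range m, push R T^[j] c := by
  simp [tau, resol, hi, push_pow]

theorem commute_tau {φ : Module.End R (List X →₀ R)}
    (h : ∀ c, φ (push R T c) = push R T (φ c)) (i : ℕ) (c : List X →₀ R) :
    φ (tau R T m i c) = tau R T m i (φ c) := by
  have hcomm : φ * (push R T : Module.End R (List X →₀ R)) = push R T * φ := LinearMap.ext h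
  exact LinearMap.congr_fun
    (commute_resol (A := Module.End R (List X →₀ R)) (show Commute φ _ from hcomm) m i).eq c

theorem boundary_tau (i : ℕ) (c : List X →₀ R) :
    boundary R (tau R T m i c) = tau R T m i (boundary R c) :=
  commute_tau (boundary_push T) i c

variable (R T m) in
/-- Chains of dimension `i` at the top of a partial lift `c₀, …, cᵢ` of the periodic resolution:
`c₀` has augmentation `1` and `∂ cᵢ₊₁ = tau i cᵢ`. -/
def IsResolving : ℕ → (List X →₀ R) → Prop
  | 0, c => boundary R c = tuple R []
  | i + 1, c => ∃ b, IsResolving i b ∧ boundary R c = tau R T m i b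

theorem push_comm {f : X → X} (hf : ∀ x, f (T x) = T (f x)) (c : List X →₀ R) :
    push R f (push R T c) = push R T (push R f c) := by
  refine LinearMap.congr_fun (f := push R f ∘ₗ push R T) (g := push R T ∘ₗ push R f)
    (hom_ext_tuple fun l => ?_) c
  simp only [LinearMap.comp_apply, push_tuple, List.map_map]
  congr 2
  exact funext hf

theorem IsResolving.map_push {f : X → X} (hf : ∀ x, f (T x) = T (f x)) {i : ℕ} {c : List X →₀ R}
    (hc : IsResolving R T m i c) : IsResolving R T m i (push R f c) := by
  induction i generalizing c with
  | zero =>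
    have hc' : boundary R c = tuple R [] := hc
    change boundary R _ = _
    rw [boundary_push, hc', push_tuple, List.map_nil]
  | succ i ih =>
    obtain ⟨b, hb, hcb⟩ := hc
    refine ⟨_, ih hb, ?_⟩
    rw [boundary_push, hcb]
    exact commute_tau (push_comm hf) i b

theorem IsResolving.boundary_tau_eq_zero (hT : T^[m] = id) {i : ℕ} {c : List X →₀ R}
    (hc : IsResolving R T m i c) : boundary R (tau R T m i c) = 0 := by
  rw [boundary_tau]
  cases i with
  | zero =>
    have hc' : boundary R c = tuple R [] := hc
    rw [hc', tau_apply_even Even.zero, push_tuple, List.map_nil, sub_self]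
  | succ i =>
    obtain ⟨b, -, hcb⟩ := hc
    rw [hcb, tau_tau hT]

end Cyclic

section Cocycle

variable {X : Type*}

/-- `h x` is the number of steps in which iterating `T` moves `x` into a fixed fundamental domain
`{x | h x = 0}`, where orbits have length `m`. -/
structure IsLabel (T : X → X) (m : ℕ) (h : X → ℕ) : Prop where
  lt : ∀ x, h x < m
  step : ∀ x, h x ≠ 0 → h (T x) + 1 = h x
  wrap : ∀ x, h x = 0 → h (T x) + 1 = m

variable {T : X → X} {m : ℕ} {h : X → ℕ}

theorem IsLabel.iterate_eq (hh : IsLabel T m h) {x y : X} (hxy : h x = h y) (j : ℕ) :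
    h (T^[j] x) = h (T^[j] y) := by
  induction j with
  | zero => exact hxy
  | succ j ih =>
    rw [Function.iterate_succ_apply', Function.iterate_succ_apply']
    by_cases h0 : h (T^[j] x) = 0
    · have h1 := hh.wrap _ h0
      have h2 := hh.wrap _ (ih ▸ h0)
      omega
    · have h1 := hh.step _ h0
      have h2 := hh.step _ (ih ▸ h0)
      omega

theorem IsLabel.iterate_add (hh : IsLabel T m h) (x : X) {j : ℕ} (hj : j < m) :
    h (T^[j] x) + j = if j ≤ h x then h x else m + h x := by
  induction j with
  | zero => simp
  | succ j ih =>
    have ih := ih (by omega)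
    rw [Function.iterate_succ_apply']
    by_cases h0 : h (T^[j] x) = 0
    · have h1 := hh.wrap _ h0
      split_ifs at ih ⊢ <;> omega
    · have h1 := hh.step _ h0
      split_ifs at ih ⊢ <;> omega

theorem IsLabel.iterate_eq_zero_iff (hh : IsLabel T m h) (x : X) {j : ℕ} (hj : j < m) :
    h (T^[j] x) = 0 ↔ j = h x := by
  have := hh.iterate_add x hj
  have := hh.lt x
  split_ifs at * <;> omega

variable (R : Type*) [CommRing R]

variable (T) in
/-- The operator applied by the section of `tau R T m i` to tuples whose first label is `k`. -/
noncomputable def slice (i k : ℕ) : (List X →₀ R) →ₗ[R] (List X →₀ R) :=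
  if Even i then -∑ j ∈ range k, push R T^[j] else if k = 0 then LinearMap.id else 0

variable (T h) in
/-- A section of `tau R T m i`, up to the image of `tau R T m (i + 1)`. -/
noncomputable def sect (i : ℕ) : (List X →₀ R) →ₗ[R] (List X →₀ R) :=
  Finsupp.linearCombination R fun
    | [] => 0
    | x :: l => slice T R i (h x) (tuple R (x :: l))

variable (T) in
/-- The iterated connecting cocycle determined by a sequence of labels. -/
noncomputable def cocycle (h : ℕ → X → ℕ) : ℕ → ((List X →₀ R) →ₗ[R] R)
  | 0 => Finsupp.lapply [] ∘ₗ boundary R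
  | i + 1 => cocycle h i ∘ₗ sect T (h i) R i ∘ₗ boundary R

variable {R}

@[simp]
theorem sect_nil (i : ℕ) : sect T h R i (tuple R []) = 0 := by
  simp [sect]

@[simp]
theorem sect_cons (i : ℕ) (x : X) (l : List X) :
    sect T h R i (tuple R (x :: l)) = slice T R i (h x) (tuple R (x :: l)) := by
  simp [sect]

theorem sect_cone (i : ℕ) (x : X) (c : List X →₀ R) :
    sect T h R i (cone R x c) = slice T R i (h x) (cone R x c) := by
  refine LinearMap.congr_fun (f := sect T h R i ∘ₗ cone R x)
    (g := slice T R i (h x) ∘ₗ cone R x) (hom_ext_tuple fun l => ?_) c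
  simp only [LinearMap.comp_apply, cone_tuple, sect_cons]

theorem slice_even {i : ℕ} (hi : Even i) (k : ℕ) (c : List X →₀ R) :
    slice T R i k c = -∑ j ∈ range k, push R T^[j] c := by
  simp [slice, hi]

theorem slice_odd {i : ℕ} (hi : ¬ Even i) (k : ℕ) (c : List X →₀ R) :
    slice T R i k c = if k = 0 then c else 0 := by
  by_cases hk : k = 0 <;> simp [slice, hi, hk]

theorem boundary_slice (i k : ℕ) (c : List X →₀ R) :
    boundary R (slice T R i k c) = slice T R i k (boundary R c) := by
  by_cases hi : Even i
  · simp only [slice_even hi, map_neg, map_sum, boundary_push]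
  · simp only [slice_odd hi]
    split_ifs <;> simp

/-- `slice` moves a tuple only along its orbit. -/
theorem map_slice_tuple_eq_zero {ψ : (List X →₀ R) →ₗ[R] R} {l : List X}
    (hψ : ∀ j, ψ (tuple R (l.map T^[j])) = 0) (i k : ℕ) : ψ (slice T R i k (tuple R l)) = 0 := by
  by_cases hi : Even i
  · simp only [slice_even hi, map_neg, map_sum, push_tuple, hψ, sum_const_zero, neg_zero]
  · rw [slice_odd hi]
    split_ifs
    · simpa using hψ 0
    · exact map_zero _

theorem map_sect_tau (hh : IsLabel T m h) {i : ℕ} {ψ : (List X →₀ R) →ₗ[R] R}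
    (hnil : ψ (tuple R []) = 0) (hψ : ∀ c, ψ (tau R T m (i + 1) c) = 0) (c : List X →₀ R) :
    ψ (sect T h R i (tau R T m i c)) = ψ c := by
  refine LinearMap.congr_fun (f := ψ ∘ₗ sect T h R i ∘ₗ tau R T m i) (g := ψ)
    (hom_ext_tuple fun l => ?_) c
  simp only [LinearMap.comp_apply]
  cases l with
  | nil =>
    by_cases hi : Even i
    · rw [tau_apply_even hi, push_tuple, List.map_nil, sub_self, map_zero, map_zero, hnil]
    · simp only [tau_apply_odd hi, push_tuple, List.map_nil, map_sum, sect_nil, map_zero,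
        sum_const_zero, hnil]
  | cons x l =>
    have hψ := hψ (tuple R (x :: l))
    have hlt := hh.lt x
    by_cases hi : Even i
    · have hi' : ¬ Even (i + 1) := by simpa [Nat.even_add_one] using hi
      rw [tau_apply_odd hi'] at hψ
      rw [tau_apply_even hi, map_sub, push_tuple, List.map_cons, sect_cons, sect_cons,
        slice_even hi, slice_even hi]
      have hT : ∀ j, push R T^[j] (tuple R (T x :: l.map T)) =
          push R T^[j + 1] (tuple R (x :: l)) := fun j => by
        simp only [push_tuple, List.map_cons, List.map_map, Function.iterate_succ]
        rfl
      simp only [hT]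
      by_cases h0 : h x = 0
      · rw [← hh.wrap x h0, sum_range_succ'] at hψ
        rw [h0, range_zero, sum_empty, neg_zero, sub_zero, map_neg]
        rw [map_add] at hψ
        rw [eq_comm, ← add_eq_zero_iff_eq_neg, add_comm]
        simpa [push_tuple] using hψ
      · rw [← hh.step x h0, sum_range_succ']
        simp [push_tuple]
    · have hi' : Even (i + 1) := by simpa [Nat.even_add_one] using hi
      have hinv : ∀ c, ψ (push R T c) = ψ c := fun c => by
        have := ‹∀ c, ψ (tau R T m (i + 1) c) = 0› c
        rwa [tau_apply_even hi', map_sub, sub_eq_zero] at this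
      have hinv' : ∀ j, ψ (tuple R ((x :: l).map T^[j])) = ψ (tuple R (x :: l)) := fun j => by
        induction j with
        | zero => simp
        | succ j ih =>
          rw [← ih, ← hinv (tuple R ((x :: l).map T^[j])), push_tuple, List.map_map,
            Function.iterate_succ']
      rw [tau_apply_odd hi, map_sum, map_sum, sum_eq_single (h x)]
      · rw [push_tuple, List.map_cons, sect_cons, slice_odd hi,
          if_pos ((hh.iterate_eq_zero_iff x hlt).2 rfl), ← List.map_cons, hinv']
      · intro j hj hne
        rw [push_tuple, List.map_cons, sect_cons, slice_odd hi,
          if_neg fun h0 => hne ((hh.iterate_eq_zero_iff x (mem_range.1 hj)).1 h0), map_zero]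
      · exact fun hx => absurd (mem_range.2 hlt) hx

variable {h : ℕ → X → ℕ}

theorem cocycle_nil (i : ℕ) : cocycle T R h i (tuple R []) = 0 := by
  cases i <;> simp [cocycle, -Finsupp.single_eq_same]

theorem cocycle_boundary (i : ℕ) (c : List X →₀ R) : cocycle T R h i (boundary R c) = 0 := by
  cases i <;> simp [cocycle, boundary_boundary]

theorem cocycle_tau_succ (hh : ∀ i, IsLabel T m (h i)) (hm : (m : R) = 0) (i : ℕ)
    (c : List X →₀ R) : cocycle T R h i (tau R T m (i + 1) c) = 0 := by
  induction i generalizing c with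
  | zero =>
    have hpush : ∀ c (j : ℕ), (push R T^[j] c) [] = c [] := fun c j => by
      refine LinearMap.congr_fun (f := Finsupp.lapply [] ∘ₗ push R T^[j])
        (g := Finsupp.lapply []) (hom_ext_tuple fun l => ?_) c
      cases l <;> simp [push_tuple]
    simp only [cocycle, LinearMap.comp_apply]
    rw [boundary_tau, zero_add, tau_apply_odd Nat.not_even_one]
    simp only [Finsupp.lapply_apply, Finsupp.finsetSum_apply, hpush,
      sum_const, card_range, nsmul_eq_mul, hm, zero_mul]
  | succ i ih =>
    have h2 : tau R T m (i + 1 + 1) = tau R T m i := resol_add_two _ m i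
    simp only [cocycle, LinearMap.comp_apply]
    rw [h2, boundary_tau, map_sect_tau (hh i) (cocycle_nil i) ih, cocycle_boundary]

theorem cocycle_eq_one (hh : ∀ i, IsLabel T m (h i)) (hm : (m : R) = 0) {i : ℕ}
    {c : List X →₀ R} (hc : IsResolving R T m i c) : cocycle T R h i c = 1 := by
  induction i generalizing c with
  | zero =>
    have hc' : boundary R c = tuple R [] := hc
    simp [cocycle, hc']
  | succ i ih =>
    obtain ⟨b, hb, hcb⟩ := hc
    simp only [cocycle, LinearMap.comp_apply]
    rw [hcb, map_sect_tau (hh i) (cocycle_nil i) (cocycle_tau_succ hh hm i), ih hb]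

/-- The cocycle of degree `i` vanishes on tuples on which one of the first `i` labels is
constant. -/
theorem cocycle_tuple_eq_zero (hh : ∀ i, IsLabel T m (h i)) {i k : ℕ} (hk : k < i) {l : List X}
    (hl : ∀ x ∈ l, ∀ y ∈ l, h k x = h k y) : cocycle T R h i (tuple R l) = 0 := by
  induction i generalizing l with
  | zero => omega
  | succ i ih =>
    match l with
    | [] => exact cocycle_nil _
    | [x] =>
      simp only [cocycle, LinearMap.comp_apply, boundary_cons, boundary_nil, map_zero, sub_zero,
        sect_nil]
    | x :: y :: l =>
      have key : cocycle T R h (i + 1) (tuple R (x :: y :: l)) =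
          cocycle T R h i (slice T R i (h i y) (tuple R (y :: l))) -
            cocycle T R h i (slice T R i (h i x) (tuple R (y :: l))) := by
        have hx : cone R x (boundary R (tuple R (y :: l))) =
            tuple R (y :: l) - boundary R (tuple R (x :: y :: l)) := by
          rw [boundary_cons x, sub_sub_cancel]
        simp only [cocycle, LinearMap.comp_apply]
        rw [boundary_cons x, map_sub, sect_cons, sect_cone, hx, map_sub, map_sub (slice T R i _),
          ← boundary_slice, map_sub _ _ (boundary R _), cocycle_boundary, sub_zero]
      rw [key]
      rcases Nat.lt_succ_iff_lt_or_eq.1 hk with hk | rfl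
      · have hz : ∀ j, cocycle T R h i (tuple R ((y :: l).map T^[j])) = 0 := fun j => by
          refine ih hk fun a ha b hb => ?_
          obtain ⟨a', ha', rfl⟩ := List.mem_map.1 ha
          obtain ⟨b', hb', rfl⟩ := List.mem_map.1 hb
          exact (hh k).iterate_eq (hl a' (List.mem_cons_of_mem _ ha') b'
            (List.mem_cons_of_mem _ hb')) j
        rw [map_slice_tuple_eq_zero hz, map_slice_tuple_eq_zero hz, sub_zero]
      · rw [hl y (by simp) x (by simp), sub_self]

end Cocycle

section Topology

variable {X : Type*} {T : X → X} {m : ℕ}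

/-- A freely acting cyclic permutation has a label vanishing on any given set that meets each orbit
at most once. -/
theorem exists_isLabel (hm : 0 < m) (hT : T^[m] = id)
    (hfree : ∀ j, 0 < j → j < m → ∀ x, T^[j] x ≠ x) {U : Set X}
    (hU : ∀ j, 0 < j → j < m → ∀ x ∈ U, T^[j] x ∉ U) :
    ∃ h, IsLabel T m h ∧ ∀ x ∈ U, h x = 0 := by
  classical
  let O : X → Set X := fun x => {y | ∃ j, T^[j] x = y}
  have hO : ∀ x, O (T x) = O x := fun x => by
    ext y
    constructor
    · rintro ⟨j, rfl⟩
      exact ⟨j + 1, rfl⟩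
    · rintro ⟨j, rfl⟩
      refine ⟨j + (m - 1), ?_⟩
      rw [Function.iterate_add_apply, ← Function.iterate_succ_apply, Nat.succ_eq_add_one,
        Nat.sub_add_cancel hm, hT, id]
  have hself : ∀ x, x ∈ O x := fun x => ⟨0, rfl⟩
  have hne : ∀ x, (O x).Nonempty := fun x => ⟨x, hself x⟩
  let r : X → X := fun x =>
    if hx : (O x ∩ U).Nonempty then hx.some else (hne x).some
  have hrT : ∀ x, r (T x) = r x := fun x => by simp only [r, hO]
  have hrO : ∀ x, r x ∈ O x := fun x => by
    by_cases hx : (O x ∩ U).Nonempty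
    · simpa only [r, dif_pos hx] using hx.some_mem.1
    · simpa only [r, dif_neg hx] using (hne x).some_mem
  have hrU : ∀ x ∈ U, r x ∈ U := fun x hxU => by
    have hx : (O x ∩ U).Nonempty := ⟨x, hself x, hxU⟩
    simpa only [r, dif_pos hx] using hx.some_mem.2
  have hex : ∀ x, ∃ k < m, T^[k] x = r x := fun x => by
    obtain ⟨j, hj⟩ := hrO x
    refine ⟨j % m, Nat.mod_lt _ hm, ?_⟩
    rw [← hj]
    exact Function.IsPeriodicPt.iterate_mod_apply (congr_fun hT x : T^[m] x = x) j
  choose h hlt hr using hex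
  have huniq : ∀ x j k, j ≤ k → k < m → T^[j] x = T^[k] x → j = k := fun x j k hjk hk he => by
    by_contra hne
    refine hfree (k - j) (by omega) (by omega) (T^[j] x) ?_
    rw [← Function.iterate_add_apply, Nat.sub_add_cancel hjk, he]
  have huniq' : ∀ x j, j < m → T^[j] x = r x → h x = j := fun x j hj he => by
    rcases le_total j (h x) with hle | hle
    · exact (huniq x _ _ hle (hlt x) (he.trans (hr x).symm)).symm
    · exact huniq x _ _ hle hj ((hr x).trans he.symm)
  refine ⟨h, ⟨hlt, fun x h0 => ?_, fun x h0 => ?_⟩, fun x hx => ?_⟩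
  · obtain ⟨k, hk⟩ := Nat.exists_eq_succ_of_ne_zero h0
    have := hlt x
    rw [hk, huniq' (T x) k (by omega)]
    rw [hrT, ← hr x, hk, Function.iterate_succ_apply]
  · rw [huniq' (T x) (m - 1) (by omega), Nat.sub_add_cancel hm]
    rw [hrT, ← hr x, h0, ← Function.iterate_succ_apply, Nat.succ_eq_add_one,
      Nat.sub_add_cancel hm, hT]
    rfl
  · by_contra h0
    exact hU (h x) (Nat.pos_of_ne_zero h0) (hlt x) x hx (hr x ▸ hrU x hx)

variable [UniformSpace X] [CompactSpace X]

/-- Finitely many labels, one of which is constant on any sufficiently small set. -/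
theorem exists_labels [T2Space X] (hm : 0 < m) (hcont : Continuous T) (hT : T^[m] = id)
    (hfree : ∀ j, 0 < j → j < m → ∀ x, T^[j] x ≠ x) (x₀ : X) :
    ∃ (h : ℕ → X → ℕ) (M : ℕ) (V : Set (X × X)), V ∈ 𝓤 X ∧ (∀ i, IsLabel T m (h i)) ∧
      ∀ l : List X, (∀ a ∈ l, ∀ b ∈ l, (a, b) ∈ V) →
        ∃ k < M, ∀ a ∈ l, ∀ b ∈ l, h k a = h k b := by
  have hU : ∀ x : X, ∃ U : Set X, IsOpen U ∧ x ∈ U ∧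
      ∀ j, 0 < j → j < m → ∀ y ∈ U, T^[j] y ∉ U := fun x => by
    have hj : ∀ j : ℕ, ∃ U : Set X, IsOpen U ∧ x ∈ U ∧
        (0 < j → j < m → ∀ y ∈ U, T^[j] y ∉ U) := fun j => by
      by_cases hj : 0 < j ∧ j < m
      · obtain ⟨A, B, hA, hB, hxA, hxB, hAB⟩ := t2_separation (hfree j hj.1 hj.2 x)
        refine ⟨T^[j] ⁻¹' A ∩ B, (hA.preimage (hcont.iterate j)).inter hB, ⟨hxA, hxB⟩,
          fun _ _ y hy hy' => Set.disjoint_left.1 hAB hy.1 hy'.2⟩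
      · exact ⟨Set.univ, isOpen_univ, trivial, fun h₁ h₂ => absurd ⟨h₁, h₂⟩ hj⟩
    choose U hUo hxU hUj using hj
    refine ⟨⋂ j ∈ range m, U j, isOpen_biInter_finset fun j _ => hUo j,
      Set.mem_iInter₂.2 fun j _ => hxU j, fun j h0 hjm y hy hy' => ?_⟩
    exact hUj j h0 hjm y (Set.mem_iInter₂.1 hy j (mem_range.2 hjm))
      (Set.mem_iInter₂.1 hy' j (mem_range.2 hjm))
  choose U hUo hxU hUj using hU
  choose h hh h0 using fun x => exists_isLabel hm hT hfree (hUj x)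
  obtain ⟨t, ht⟩ := isCompact_univ.elim_finite_subcover U hUo
    fun x _ => Set.mem_iUnion.2 ⟨x, hxU x⟩
  obtain ⟨V, hV, hVU⟩ := lebesgue_number_lemma (U := fun x : t => U x) isCompact_univ
    (fun x => hUo x) fun y hy => by simpa using Set.mem_iUnion₂.1 (ht hy)
  refine ⟨fun i => h (t.toList.getD i x₀), t.card + 1, V, hV, fun i => hh _, fun l hl => ?_⟩
  cases l with
  | nil => exact ⟨0, by omega, by simp⟩
  | cons a l =>
    obtain ⟨x, hx⟩ := hVU a trivial
    obtain ⟨k, hk, hkx⟩ := List.getElem_of_mem (Finset.mem_toList.2 x.2)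
    have hget : t.toList.getD k x₀ = x := by rw [List.getD_eq_getElem _ _ hk, hkx]
    have hzero : ∀ b ∈ a :: l, h (t.toList.getD k x₀) b = 0 := fun b hb => by
      rw [hget]
      exact h0 _ b (hx (hl a (by simp) b hb))
    refine ⟨k, by rw [Finset.length_toList] at hk; omega, fun b hb c hc => ?_⟩
    exact (hzero b hb).trans (hzero c hc).symm

/-- A nullhomotopic map sends sufficiently small cycles to boundaries of small chains. -/
theorem exists_small_boundary_eq_push (R : Type*) [CommRing R] {f : C(X, X)}
    (hf : f.Nullhomotopic) {V : Set (X × X)} (hV : V ∈ 𝓤 X) :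
    ∃ W ∈ 𝓤 X, ∀ z ∈ small R W, boundary R z = 0 →
      ∃ c ∈ small R V, boundary R c = push R f z := by
  obtain ⟨y, ⟨H⟩⟩ := hf
  have hH := CompactSpace.uniformContinuous_of_continuous H.continuous
  have hHV := hH hV
  rw [Filter.mem_map, uniformity_prod, Filter.mem_inf_iff_superset] at hHV
  obtain ⟨A, hA, B, hB, hAB⟩ := hHV
  obtain ⟨I, hI, hIA⟩ := Filter.mem_comap.1 hA
  obtain ⟨W, hW, hWB⟩ := Filter.mem_comap.1 hB
  have key : ∀ s t a b, (s, t) ∈ I → (a, b) ∈ W → (H (s, a), H (t, b)) ∈ V :=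
    fun s t a b hst hab => @hAB ((s, a), (t, b))
      ⟨@hIA ((s, a), (t, b)) hst, @hWB ((s, a), (t, b)) hab⟩
  refine ⟨W, hW, fun z hz hz0 => ?_⟩
  let P : unitInterval → Prop := fun t =>
    ∃ c ∈ small R V, boundary R c = push R (fun x => H (t, x)) z
  have hP : ∀ s t, (s, t) ∈ I → (t, s) ∈ I → P s → P t := fun s t hst hts ⟨c, hc, hcs⟩ => by
    refine ⟨c + prism R (fun x => H (s, x)) (fun x => H (t, x)) z, add_mem hc ?_, ?_⟩
    · exact prism_mem_small (fun a b hab => ⟨key _ _ _ _ (refl_mem_uniformity hI) hab,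
        key _ _ _ _ hst hab, key _ _ _ _ hts hab, key _ _ _ _ (refl_mem_uniformity hI) hab⟩) hz
    · rw [map_add, hcs, boundary_prism, hz0, map_zero]
      abel
  have hloc : IsLocallyConstant P := by
    rw [IsLocallyConstant.iff_eventually_eq]
    intro s
    filter_upwards [mem_nhds_left s hI, mem_nhds_right s hI] with t h₁ h₂
    exact propext ⟨hP t s h₂ h₁, hP s t h₁ h₂⟩
  have h1 : P 1 := by
    refine ⟨cone R y (push R (fun x => H (1, x)) z), ?_, ?_⟩
    · have hcone := map_mem_of_mem_small (φ := cone R y ∘ₗ push R (fun x => H (1, x)))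
        (N := small R V) (fun l hl => ?_) hz
      · exact hcone
      · simp only [LinearMap.comp_apply, push_tuple, cone_tuple]
        have hy : ∀ a ∈ y :: l.map (fun x => H (1, x)), a = y := by simp
        refine tuple_mem_small fun a ha b hb => ?_
        rw [hy a ha, hy b hb]
        exact refl_mem_uniformity hV
    · rw [boundary_cone, boundary_push, hz0, map_zero, map_zero, sub_zero]
  have h0 : P 0 := by rwa [hloc.apply_eq_of_preconnectedSpace 0 1]
  simpa [P] using h0

/-- **Dold's theorem** for a free cyclic permutation of a compact Hausdorff space. -/
theorem not_nullhomotopic_of_iterate_ne [T2Space X] (hm : 1 < m) (hcont : Continuous T)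
    (hT : T^[m] = id) (hfree : ∀ j, 0 < j → j < m → ∀ x, T^[j] x ≠ x) (f : C(X, X))
    (hf : ∀ x, f (T x) = T (f x)) : ¬ f.Nullhomotopic := by
  intro hnull
  have : Fact (1 < m) := ⟨hm⟩
  have hres : ∀ (i : ℕ) (V : Set (X × X)), V ∈ 𝓤 X →
      ∃ c ∈ small (ZMod m) V, IsResolving (ZMod m) T m i c := by
    intro i
    induction i with
    | zero =>
      intro V hV
      obtain ⟨y, -⟩ := hnull
      refine ⟨tuple (ZMod m) [y], tuple_mem_small fun a ha b hb => ?_, ?_⟩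
      · rw [List.mem_singleton.1 ha, List.mem_singleton.1 hb]
        exact refl_mem_uniformity hV
      · change boundary _ _ = _
        rw [boundary_cons, boundary_nil, map_zero, sub_zero]
    | succ i ih =>
      intro V hV
      obtain ⟨W, hW, hWV⟩ := exists_small_boundary_eq_push (ZMod m) hnull hV
      obtain ⟨b, hb, hbres⟩ := ih (⋂ j ∈ range (m + 1), Prod.map T^[j] T^[j] ⁻¹' W)
        ((Filter.biInter_finset_mem _).2 fun j _ =>
          CompactSpace.uniformContinuous_of_continuous (hcont.iterate j) hW)
      have hpush : ∀ j ≤ m, push (ZMod m) T^[j] b ∈ small (ZMod m) W := fun j hj =>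
        push_mem_small (fun x y hxy => Set.mem_iInter₂.1 hxy j (mem_range.2 (by omega))) hb
      have htau : tau (ZMod m) T m i b ∈ small (ZMod m) W := by
        by_cases hi : Even i
        · rw [tau_apply_even hi]
          refine sub_mem (hpush 1 hm.le) ?_
          simpa [push] using hpush 0 (Nat.zero_le _)
        · rw [tau_apply_odd hi]
          exact sum_mem fun j hj => hpush j (mem_range.1 hj).le
      obtain ⟨c, hc, hcb⟩ := hWV _ htau (hbres.boundary_tau_eq_zero hT)
      exact ⟨c, hc, _, hbres.map_push hf, hcb.trans (commute_tau (push_comm hf) i b)⟩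
  obtain ⟨x₀, -⟩ := id hnull
  obtain ⟨h, M, V, hV, hh, hconst⟩ := exists_labels (by omega) hcont hT hfree x₀
  obtain ⟨c, hc, hcres⟩ := hres M V hV
  have hone := cocycle_eq_one hh (ZMod.natCast_self m) hcres
  have hzero : cocycle T (ZMod m) h M c ∈ (⊥ : Submodule (ZMod m) (ZMod m)) := by
    refine map_mem_of_mem_small (fun l hl => ?_) hc
    obtain ⟨k, hk, hkl⟩ := hconst l hl
    exact cocycle_tuple_eq_zero hh hk hkl
  exact one_ne_zero (hone.symm.trans hzero)

end Topology

end OrderedChain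

/-- **Dold's theorem for spheres**: if a nontrivial finite group `G` acts continuously and
freely on `S^n`, then no continuous `G`-equivariant selfmap of `S^n` is nullhomotopic. -/
theorem dold_no_nullhomotopic_equivariant_selfmap (n : ℕ)
    (G : Type*) [Group G] [Finite G] [Nontrivial G] [TopologicalSpace G]
    [MulAction G (Metric.sphere (0 : EuclideanSpace ℝ (Fin (n + 1))) 1)]
    [ContinuousSMul G (Metric.sphere (0 : EuclideanSpace ℝ (Fin (n + 1))) 1)]
    (hfree : ∀ g : G, g ≠ 1 →
      ∀ x : (Metric.sphere (0 : EuclideanSpace ℝ (Fin (n + 1))) 1), g • x ≠ x)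
    (f : C((Metric.sphere (0 : EuclideanSpace ℝ (Fin (n + 1))) 1),
      (Metric.sphere (0 : EuclideanSpace ℝ (Fin (n + 1))) 1)))
    (hequiv : ∀ (g : G) (x : (Metric.sphere (0 : EuclideanSpace ℝ (Fin (n + 1))) 1)),
      f (g • x) = g • f x) :
    ¬ f.Nullhomotopic := by
  obtain ⟨g, hg⟩ := exists_ne (1 : G)
  refine OrderedChain.not_nullhomotopic_of_iterate_ne (T := (g • ·)) (m := orderOf g) ?_
    (continuous_const_smul g) ?_ (fun j h0 hj x => ?_) f (hequiv g)
  · have h0 := orderOf_pos g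
    have h1 : orderOf g ≠ 1 := fun h => hg (orderOf_eq_one_iff.1 h)
    omega
  · rw [smul_iterate, pow_orderOf_eq_one]
    exact funext fun x => one_smul G x
  · rw [smul_iterate]
    exact hfree _ (pow_ne_one_of_lt_orderOf h0.ne' hj) x
end

section
/- No continuous odd selfmap of a sphere is nullhomotopic: if f : S^n → S^n is continuous and satisfies f(-x) = -f(x) for all x ∈ S^n, then f is not homotopic to a constant map. -/
/-- Mod 2 chains of ordered (possibly degenerate) simplices in `X`, in all degrees at once.
The empty list is the augmentation generator. -/
abbrev ListChain (X : Type*) := List X →₀ ZMod 2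

namespace ListChain

variable {X Y Z : Type*}

/-- The join of a chain with a first vertex. -/
noncomputable def cone (x : X) : ListChain X →ₗ[ZMod 2] ListChain X :=
  Finsupp.lmapDomain _ _ (List.cons x)

/-- The chain map induced by a map of vertices. -/
noncomputable def push (f : X → Y) : ListChain X →ₗ[ZMod 2] ListChain Y :=
  Finsupp.lmapDomain _ _ (List.map f)

/-- The augmented boundary of a single ordered simplex. -/
noncomputable def simplexBoundary : List X → ListChain X
  | [] => 0
  | x :: l => Finsupp.single l 1 + cone x (simplexBoundary l)

/-- The augmented boundary operator. -/
noncomputable def boundary : ListChain X →ₗ[ZMod 2] ListChain X :=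
  Finsupp.linearCombination (ZMod 2) simplexBoundary

/-- The prism over a single ordered simplex, with bottom `f` and top `g`. -/
noncomputable def simplexPrism (f g : X → Y) : List X → ListChain Y
  | [] => 0
  | x :: l => Finsupp.single (f x :: g x :: l.map g) 1 + cone (f x) (simplexPrism f g l)

/-- The prism operator, with bottom `f` and top `g`. -/
noncomputable def prism (f g : X → Y) : ListChain X →ₗ[ZMod 2] ListChain Y :=
  Finsupp.linearCombination (ZMod 2) (simplexPrism f g)

@[simp]
theorem cone_single (x : X) (l : List X) (a : ZMod 2) :
    cone x (Finsupp.single l a) = Finsupp.single (x :: l) a := by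
  simp [cone]

@[simp]
theorem push_single (f : X → Y) (l : List X) (a : ZMod 2) :
    push f (Finsupp.single l a) = Finsupp.single (l.map f) a := by
  simp [push]

@[simp]
theorem boundary_single (l : List X) (a : ZMod 2) :
    boundary (Finsupp.single l a) = a • simplexBoundary l := by
  simp [boundary]

@[simp]
theorem prism_single (f g : X → Y) (l : List X) (a : ZMod 2) :
    prism f g (Finsupp.single l a) = a • simplexPrism f g l := by
  simp [prism]

/-- Linear maps out of chains agree as soon as they agree on simplices. -/
theorem linearMap_congr {M : Type*} [AddCommGroup M] [Module (ZMod 2) M]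
    {φ ψ : ListChain X →ₗ[ZMod 2] M}
    (h : ∀ l, φ (Finsupp.single l 1) = ψ (Finsupp.single l 1)) (c : ListChain X) :
    φ c = ψ c := by
  have : φ = ψ := Finsupp.lhom_ext' fun l => LinearMap.ext_ring (h l)
  rw [this]

theorem boundary_cone (x : X) (c : ListChain X) :
    boundary (cone x c) = c + cone x (boundary c) :=
  linearMap_congr (φ := boundary ∘ₗ cone x) (ψ := LinearMap.id + cone x ∘ₗ boundary)
    (fun l => by simp [simplexBoundary]) c

theorem push_cone (f : X → Y) (x : X) (c : ListChain X) :
    push f (cone x c) = cone (f x) (push f c) :=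
  linearMap_congr (φ := push f ∘ₗ cone x) (ψ := cone (f x) ∘ₗ push f) (fun l => by simp) c

theorem push_push (g : Y → Z) (f : X → Y) (c : ListChain X) :
    push g (push f c) = push (g ∘ f) c :=
  linearMap_congr (φ := push g ∘ₗ push f) (ψ := push (g ∘ f)) (fun l => by simp) c

theorem boundary_push (f : X → Y) (c : ListChain X) :
    boundary (push f c) = push f (boundary c) := by
  refine linearMap_congr (φ := boundary ∘ₗ push f) (ψ := push f ∘ₗ boundary) (fun l => ?_) c
  simp only [LinearMap.comp_apply, push_single, boundary_single, one_smul]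
  induction l with
  | nil => simp [simplexBoundary]
  | cons x l ih => simp [simplexBoundary, ih, push_cone]

theorem prism_cone (f g : X → Y) (x : X) (c : ListChain X) :
    prism f g (cone x c) = cone (f x) (cone (g x) (push g c)) + cone (f x) (prism f g c) :=
  linearMap_congr (φ := prism f g ∘ₗ cone x)
    (ψ := cone (f x) ∘ₗ cone (g x) ∘ₗ push g + cone (f x) ∘ₗ prism f g)
    (fun l => by simp [simplexPrism]) c

theorem boundary_prism (f g : X → Y) (c : ListChain X) :
    boundary (prism f g c) = push f c + push g c + prism f g (boundary c) := by
  refine linearMap_congr (φ := boundary ∘ₗ prism f g)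
    (ψ := push f + push g + prism f g ∘ₗ boundary) (fun l => ?_) c
  simp only [LinearMap.comp_apply, LinearMap.add_apply, prism_single, push_single,
    boundary_single, one_smul]
  induction l with
  | nil => simp [simplexBoundary, simplexPrism, ZModModule.add_self]
  | cons x l ih =>
    have hpush : push g (simplexBoundary l) = simplexBoundary (l.map g) := by
      simpa using (boundary_push g (Finsupp.single l 1)).symm
    have hcancel := ZModModule.add_self (Finsupp.single (f x :: l.map g) 1 : ListChain Y)
    simp only [simplexPrism, simplexBoundary, map_add, boundary_single, boundary_cone, ih,
      prism_single, prism_cone, one_smul, cone_single, hpush, List.map_cons]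
    linear_combination (norm := module) hcancel

/-- Chains all of whose simplices have `k` vertices at mutual distance less than `ε`. -/
def small (X : Type*) [PseudoMetricSpace X] (k : ℕ) (ε : ℝ) : Submodule (ZMod 2) (ListChain X) :=
  Finsupp.supported (ZMod 2) (ZMod 2) {l | l.length = k ∧ ∀ a ∈ l, ∀ b ∈ l, dist a b < ε}

theorem single_mem_small [PseudoMetricSpace X] {k : ℕ} {ε : ℝ} {l : List X}
    (hl : l.length = k) (h : ∀ a ∈ l, ∀ b ∈ l, dist a b < ε) :
    Finsupp.single l 1 ∈ small X k ε :=
  Finsupp.single_mem_supported _ _ ⟨hl, h⟩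

theorem map_mem_of_mem_small [PseudoMetricSpace X] {M : Type*} [AddCommGroup M]
    [Module (ZMod 2) M] {k : ℕ} {ε : ℝ} (φ : ListChain X →ₗ[ZMod 2] M) (S : Submodule (ZMod 2) M)
    (h : ∀ l : List X, l.length = k → (∀ a ∈ l, ∀ b ∈ l, dist a b < ε) →
      φ (Finsupp.single l 1) ∈ S) {c : ListChain X} (hc : c ∈ small X k ε) : φ c ∈ S := by
  have : small X k ε ≤ S.comap φ := by
    rw [small, Finsupp.supported_eq_span_single, Submodule.span_le]
    rintro _ ⟨l, hl, rfl⟩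
    exact h l hl.1 hl.2
  exact this hc

theorem push_mem_small [PseudoMetricSpace X] [PseudoMetricSpace Y] {k : ℕ} {δ ε : ℝ} {f : X → Y}
    (hf : ∀ a b, dist a b < δ → dist (f a) (f b) < ε) {c : ListChain X} (hc : c ∈ small X k δ) :
    push f c ∈ small Y k ε := by
  refine map_mem_of_mem_small _ _ (fun l hl h => ?_) hc
  rw [push_single]
  refine single_mem_small (by simpa using hl) ?_
  simp only [List.mem_map]
  rintro _ ⟨a, ha, rfl⟩ _ ⟨b, hb, rfl⟩
  exact hf a b (h a ha b hb)

theorem simplexPrism_mem_supported (f g : X → Y) (l : List X) :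
    simplexPrism f g l ∈ Finsupp.supported (ZMod 2) (ZMod 2)
      {m | m.length = l.length + 1 ∧ ∀ b ∈ m, ∃ a ∈ l, b = f a ∨ b = g a} := by
  induction l with
  | nil => simp [simplexPrism]
  | cons x l ih =>
    refine add_mem (Finsupp.single_mem_supported _ _ ⟨by simp, ?_⟩) ?_
    · simp only [List.mem_cons, List.mem_map]
      rintro b (rfl | rfl | ⟨a, ha, rfl⟩)
      · exact ⟨x, by simp⟩
      · exact ⟨x, by simp⟩
      · exact ⟨a, by simp [ha]⟩
    · rw [Finsupp.supported_eq_span_single] at ih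
      refine Submodule.span_le.2 ?_ (Submodule.apply_mem_span_image_of_mem_span (cone (f x)) ih)
      rintro _ ⟨_, ⟨m, ⟨hm, hml⟩, rfl⟩, rfl⟩
      rw [SetLike.mem_coe, cone_single]
      refine Finsupp.single_mem_supported _ _ ⟨by simp [hm], ?_⟩
      simp only [List.mem_cons]
      rintro b (rfl | hb)
      · exact ⟨x, by simp⟩
      · obtain ⟨a, ha, h⟩ := hml b hb
        exact ⟨a, Or.inr ha, h⟩

theorem prism_mem_small [PseudoMetricSpace X] [PseudoMetricSpace Y] {k : ℕ} {δ ε : ℝ} {f g : X → Y}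
    (hff : ∀ a b, dist a b < δ → dist (f a) (f b) < ε)
    (hfg : ∀ a b, dist a b < δ → dist (f a) (g b) < ε)
    (hgg : ∀ a b, dist a b < δ → dist (g a) (g b) < ε) {c : ListChain X} (hc : c ∈ small X k δ) :
    prism f g c ∈ small Y (k + 1) ε := by
  refine map_mem_of_mem_small _ _ (fun l hl h => ?_) hc
  rw [prism_single, one_smul]
  refine Finsupp.supported_mono ?_ (simplexPrism_mem_supported f g l)
  rintro m ⟨hm, hml⟩
  refine ⟨by rw [hm, hl], fun a ha b hb => ?_⟩
  obtain ⟨x, hx, rfl | rfl⟩ := hml a ha <;> obtain ⟨y, hy, rfl | rfl⟩ := hml b hb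
  · exact hff x y (h x hx y hy)
  · exact hfg x y (h x hx y hy)
  · rw [dist_comm]
    exact hfg y x (h y hy x hx)
  · exact hgg x y (h x hx y hy)

theorem exists_boundary_eq_of_homotopy [MetricSpace X] [CompactSpace X] [MetricSpace Y]
    {H : unitInterval × X → Y} (hH : Continuous H) {p : Y} (hp : ∀ x, H (1, x) = p)
    {ε : ℝ} (hε : 0 < ε) :
    ∃ δ > 0, ∀ k, ∀ c ∈ small X k δ, boundary c = 0 →
      ∃ d ∈ small Y (k + 1) ε, boundary d = push (fun x => H (0, x)) c := by
  obtain ⟨δ, hδ, hu⟩ := Metric.uniformContinuous_iff.1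
    (CompactSpace.uniformContinuous_of_continuous hH) ε hε
  refine ⟨δ, hδ, fun k c hc hbc => ?_⟩
  obtain ⟨N, hN⟩ := exists_nat_one_div_lt hδ
  have key : ∀ s t : unitInterval, dist s t < δ → ∀ a b, dist a b < δ →
      dist (H (s, a)) (H (t, b)) < ε := fun s t hst a b hab =>
    hu (by rw [Prod.dist_eq]; exact max_lt hst hab)
  have hN0 : (0 : ℝ) < N + 1 := by positivity
  let t : ℕ → unitInterval := fun j => Set.projIcc 0 1 zero_le_one ((j : ℝ) / (N + 1))
  have ht : ∀ j, dist (t j) (t (j + 1)) < δ := fun j => by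
    refine lt_of_le_of_lt ((LipschitzWith.projIcc (zero_le_one' ℝ)).dist_le_mul _ _) ?_
    have : (j : ℝ) / (N + 1) - ((j + 1 : ℕ) : ℝ) / (N + 1) = -(1 / (N + 1)) := by
      push_cast
      ring
    rw [Real.dist_eq, this, abs_neg, abs_of_pos (by positivity)]
    simpa using hN
  have ht0 : t 0 = 0 := by
    simp only [t, Nat.cast_zero, zero_div]
    exact Set.projIcc_left _
  have ht1 : t (N + 1) = 1 := by
    have : ((N + 1 : ℕ) : ℝ) / (N + 1) = 1 := by
      push_cast
      exact div_self hN0.ne'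
    simp only [t, this]
    exact Set.projIcc_right _
  have hstep : ∀ j, ∃ d ∈ small Y (k + 1) ε,
      boundary d = push (fun x => H (0, x)) c + push (fun x => H (t j, x)) c := by
    intro j
    induction j with
    | zero => exact ⟨0, zero_mem _, by rw [ht0, ZModModule.add_self, map_zero]⟩
    | succ j ih =>
      obtain ⟨d, hd, hbd⟩ := ih
      refine ⟨d + prism (fun x => H (t j, x)) (fun x => H (t (j + 1), x)) c,
        add_mem hd (prism_mem_small (key _ _ (by simpa using hδ)) (key _ _ (ht j))
          (key _ _ (by simpa using hδ)) hc), ?_⟩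
      rw [map_add, hbd, boundary_prism, hbc, map_zero]
      linear_combination (norm := module) ZModModule.add_self (push (fun x => H (t j, x)) c)
  obtain ⟨d, hd, hbd⟩ := hstep (N + 1)
  have hconst : (fun x => H (t (N + 1), x)) = fun _ => p := by
    funext x
    rw [ht1, hp]
  rw [hconst] at hbd
  refine ⟨d + cone p (push (fun _ => p) c), add_mem hd ?_, ?_⟩
  · refine map_mem_of_mem_small (cone p ∘ₗ push fun _ => p) _ (fun l hl _ => ?_) hc
    rw [LinearMap.comp_apply, push_single, cone_single]
    refine single_mem_small (by simp [hl]) ?_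
    have hmem : ∀ a ∈ p :: l.map (fun _ => p), a = p := by
      simp only [List.mem_cons, List.mem_map]
      rintro a (rfl | ⟨_, _, rfl⟩) <;> rfl
    intro a ha b hb
    rw [hmem a ha, hmem b hb, dist_self]
    exact hε
  · rw [map_add, hbd, boundary_cone, boundary_push, hbc, map_zero, map_zero]
    linear_combination (norm := module) ZModModule.add_self (push (fun _ => p) c)

/-- The top cells of an equivariant chain model of the `k`-dimensional antipodal sphere:
the boundary of the `(k + 1)`-cell is the sum of a `k`-cell and its antipode. -/
def IsAntipodalCell [InvolutiveNeg X] : ℕ → ListChain X → Prop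
  | 0, c => boundary c = Finsupp.single [] 1
  | k + 1, c => ∃ b, IsAntipodalCell k b ∧ boundary c = b + push Neg.neg b

theorem IsAntipodalCell.push [InvolutiveNeg X] [InvolutiveNeg Y] {f : X → Y}
    (hf : ∀ x, f (-x) = -f x) {k : ℕ} {c : ListChain X} (hc : IsAntipodalCell k c) :
    IsAntipodalCell k (push f c) := by
  induction k generalizing c with
  | zero =>
    rw [IsAntipodalCell] at hc ⊢
    rw [boundary_push, hc, push_single, List.map_nil]
  | succ k ih =>
    obtain ⟨b, hb, hbc⟩ := hc
    refine ⟨_, ih hb, ?_⟩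
    rw [boundary_push, hbc, map_add, push_push, push_push]
    congr 3
    funext x
    exact hf x

theorem IsAntipodalCell.boundary_add [InvolutiveNeg X] {k : ℕ} {c : ListChain X}
    (hc : IsAntipodalCell k c) : boundary (c + ListChain.push Neg.neg c) = 0 := by
  rw [map_add, boundary_push]
  cases k with
  | zero =>
    rw [IsAntipodalCell] at hc
    rw [hc, push_single, List.map_nil, ZModModule.add_self]
  | succ k =>
    obtain ⟨b, -, hbc⟩ := hc
    have hid : (Neg.neg ∘ Neg.neg : X → X) = id := funext neg_neg
    have hb : ListChain.push (id : X → X) b = b :=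
      linearMap_congr (φ := ListChain.push id) (ψ := LinearMap.id) (fun l => by simp) b
    rw [hbc, map_add, push_push, hid, hb, add_comm b, ZModModule.add_self]

/-- The cup product of the coboundaries of `s i, s (i + 1), …`, followed by a last factor `s j`. -/
def halfSignProd (s : ℕ → X → ZMod 2) : ℕ → List X → ZMod 2
  | _, [] => 1
  | i, [x] => s i x
  | i, x :: y :: l => (s i x + s i y) * halfSignProd s (i + 1) (y :: l)

/-- The cup product of the coboundaries of `s i, s (i + 1), …`. -/
def signProd (s : ℕ → X → ZMod 2) : ℕ → List X → ZMod 2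
  | _, [] => 0
  | _, [_] => 1
  | i, x :: y :: l => (s i x + s i y) * signProd s (i + 1) (y :: l)

/-- The evaluation of a cochain on chains. -/
noncomputable def eval (φ : List X → ZMod 2) : ListChain X →ₗ[ZMod 2] ZMod 2 :=
  Finsupp.linearCombination (ZMod 2) φ

@[simp]
theorem eval_single (φ : List X → ZMod 2) (l : List X) (a : ZMod 2) :
    eval φ (Finsupp.single l a) = a * φ l := by
  simp [eval]

theorem eval_halfSignProd_cone_cone (s : ℕ → X → ZMod 2) (i : ℕ) (x y : X) (c : ListChain X) :
    eval (halfSignProd s i) (cone x (cone y c)) =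
      (s i x + s i y) * eval (halfSignProd s (i + 1)) (cone y c) :=
  linearMap_congr (φ := eval (halfSignProd s i) ∘ₗ cone x ∘ₗ cone y)
    (ψ := (s i x + s i y) • (eval (halfSignProd s (i + 1)) ∘ₗ cone y))
    (fun l => by simp [halfSignProd]) c

theorem eval_halfSignProd_simplexBoundary (s : ℕ → X → ZMod 2) (i : ℕ) (l : List X) :
    eval (halfSignProd s i) (simplexBoundary l) = signProd s i l := by
  induction l generalizing i with
  | nil => simp [simplexBoundary, signProd]
  | cons x l ih =>
    cases l with
    | nil => simp [simplexBoundary, signProd, halfSignProd]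
    | cons y l =>
      have h := ih (i + 1)
      simp only [simplexBoundary, map_add, eval_single, one_mul] at h
      simp only [simplexBoundary, map_add, eval_single, cone_single, one_mul, signProd,
        eval_halfSignProd_cone_cone, ← h]
      cases l with
      | nil =>
        simp only [halfSignProd]
        grind
      | cons z l =>
        simp only [halfSignProd]
        grind

theorem eval_halfSignProd_boundary (s : ℕ → X → ZMod 2) (i : ℕ) (c : ListChain X) :
    eval (halfSignProd s i) (boundary c) = eval (signProd s i) c :=
  linearMap_congr (φ := eval (halfSignProd s i) ∘ₗ boundary) (ψ := eval (signProd s i))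
    (fun l => by simp [eval_halfSignProd_simplexBoundary]) c

theorem halfSignProd_add_map_neg [InvolutiveNeg X] {s : ℕ → X → ZMod 2}
    (hs : ∀ i x, s i (-x) = s i x + 1) (i : ℕ) (l : List X) :
    halfSignProd s i l + halfSignProd s i (l.map Neg.neg) = signProd s i l := by
  induction l generalizing i with
  | nil => exact CharTwo.add_self_eq_zero 1
  | cons x l ih =>
    cases l with
    | nil =>
      simp only [List.map_cons, List.map_nil, halfSignProd, signProd, hs]
      grind
    | cons y l =>
      have h := ih (i + 1)
      simp only [List.map_cons] at h
      simp only [List.map_cons, halfSignProd, signProd, hs, ← h]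
      grind

theorem eval_halfSignProd_add_push_neg [InvolutiveNeg X] {s : ℕ → X → ZMod 2}
    (hs : ∀ i x, s i (-x) = s i x + 1) (i : ℕ) (c : ListChain X) :
    eval (halfSignProd s i) (c + push Neg.neg c) = eval (signProd s i) c :=
  linearMap_congr
    (φ := eval (halfSignProd s i) ∘ₗ (LinearMap.id + push Neg.neg)) (ψ := eval (signProd s i))
    (fun l => by simp [halfSignProd_add_map_neg hs]) c

theorem IsAntipodalCell.eval_signProd [InvolutiveNeg X] {s : ℕ → X → ZMod 2}
    (hs : ∀ i x, s i (-x) = s i x + 1) {k : ℕ} {c : ListChain X} (hc : IsAntipodalCell k c) :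
    eval (signProd s 0) c = 1 := by
  induction k generalizing c with
  | zero =>
    rw [IsAntipodalCell] at hc
    rw [← eval_halfSignProd_boundary, hc, eval_single]
    simp [halfSignProd]
  | succ k ih =>
    obtain ⟨b, hb, hbc⟩ := hc
    rw [← eval_halfSignProd_boundary, hbc, eval_halfSignProd_add_push_neg hs, ih hb]

theorem exists_ne_of_signProd_ne_zero {s : ℕ → X → ZMod 2} {i : ℕ} {l : List X}
    (h : signProd s i l ≠ 0) {j : ℕ} (hj : j + 1 < l.length) :
    ∃ a ∈ l, ∃ b ∈ l, s (i + j) a ≠ s (i + j) b := by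
  induction l generalizing i j with
  | nil => simp at hj
  | cons x l ih =>
    cases l with
    | nil => simp at hj
    | cons y l =>
      rw [signProd] at h
      cases j with
      | zero =>
        refine ⟨x, by simp, y, by simp, fun hxy => left_ne_zero_of_mul h ?_⟩
        simp only [add_zero] at hxy
        rw [hxy, CharTwo.add_self_eq_zero]
      | succ j =>
        obtain ⟨a, ha, b, hb, hab⟩ := ih (right_ne_zero_of_mul h)
          (j := j) (by simpa using hj)
        rw [add_right_comm, add_assoc] at hab
        exact ⟨a, List.mem_cons_of_mem _ ha, b, List.mem_cons_of_mem _ hb, hab⟩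

end ListChain

namespace EuclideanSpace

/-- The standard suspension homotopy, from the equator to the pole. -/
noncomputable def sphereSuspension (k : ℕ)
    (q : unitInterval × Metric.sphere (0 : EuclideanSpace ℝ (Fin (k + 1))) 1) :
    Metric.sphere (0 : EuclideanSpace ℝ (Fin (k + 2))) 1 :=
  ⟨WithLp.toLp 2 (Fin.cons (q.1 : ℝ) fun i => √(1 - (q.1 : ℝ) ^ 2) * (q.2 : EuclideanSpace _ _) i),
    by
      have h2 : ∑ i, (q.2 : EuclideanSpace ℝ (Fin (k + 1))) i ^ 2 = 1 := by
        rw [← EuclideanSpace.real_norm_sq_eq, norm_eq_of_mem_sphere, one_pow]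
      have h1 : 0 ≤ 1 - (q.1 : ℝ) ^ 2 := by
        nlinarith [q.1.2.1, q.1.2.2]
      rw [mem_sphere_zero_iff_norm, ← sq_eq_sq₀ (norm_nonneg _) zero_le_one,
        EuclideanSpace.real_norm_sq_eq, Fin.sum_univ_succ]
      simp only [Fin.cons_zero, Fin.cons_succ, mul_pow, Real.sq_sqrt h1, ← Finset.mul_sum, h2]
      ring⟩

theorem continuous_sphereSuspension (k : ℕ) : Continuous (sphereSuspension k) := by
  refine Continuous.subtype_mk ((PiLp.continuous_toLp 2 _).comp (continuous_pi fun i => ?_)) _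
  refine Fin.cases ?_ (fun i => ?_) i
  · simp only [Fin.cons_zero]
    fun_prop
  · simp only [Fin.cons_succ]
    fun_prop

theorem sphereSuspension_zero_neg (k : ℕ)
    (x : Metric.sphere (0 : EuclideanSpace ℝ (Fin (k + 1))) 1) :
    sphereSuspension k (0, -x) = -sphereSuspension k (0, x) := by
  ext i
  refine Fin.cases ?_ (fun i => ?_) i <;> simp [sphereSuspension]

theorem exists_sphereSuspension_one (k : ℕ) :
    ∃ p, ∀ x, sphereSuspension k (1, x) = p := by
  obtain ⟨x₀⟩ : Nonempty (Metric.sphere (0 : EuclideanSpace ℝ (Fin (k + 1))) 1) :=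
    (NormedSpace.sphere_nonempty.2 zero_le_one).to_subtype
  refine ⟨sphereSuspension k (1, x₀), fun x => ?_⟩
  ext i
  refine Fin.cases ?_ (fun i => ?_) i <;> simp [sphereSuspension]

open ListChain in
theorem exists_small_isAntipodalCell (k : ℕ) {ε : ℝ} (hε : 0 < ε) :
    ∃ c ∈ small (Metric.sphere (0 : EuclideanSpace ℝ (Fin (k + 1))) 1) (k + 1) ε,
      IsAntipodalCell k c := by
  induction k generalizing ε with
  | zero =>
    obtain ⟨x₀⟩ : Nonempty (Metric.sphere (0 : EuclideanSpace ℝ (Fin (0 + 1))) 1) :=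
      (NormedSpace.sphere_nonempty.2 zero_le_one).to_subtype
    exact ⟨Finsupp.single [x₀] 1, single_mem_small rfl (by simpa using hε),
      by simp [IsAntipodalCell, simplexBoundary]⟩
  | succ k ih =>
    obtain ⟨p, hp⟩ := exists_sphereSuspension_one k
    obtain ⟨δ, hδ, h⟩ := exists_boundary_eq_of_homotopy (continuous_sphereSuspension k) hp hε
    obtain ⟨b, hb, hbcell⟩ := ih hδ
    obtain ⟨c, hc, hbc⟩ := h _ _
      (add_mem hb (push_mem_small (fun x y hxy => by
        rwa [Subtype.dist_eq, coe_neg_sphere, coe_neg_sphere, dist_neg_neg]) hb))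
      hbcell.boundary_add
    refine ⟨c, hc, _,
      hbcell.push (f := fun x => sphereSuspension k (0, x)) (sphereSuspension_zero_neg k), ?_⟩
    rw [hbc, map_add, push_push, push_push]
    congr 3
    funext x
    exact sphereSuspension_zero_neg k x

/-- An odd function on nonzero vectors refining the sign of the `i`-th coordinate. -/
theorem exists_odd_sign (n : ℕ) (i : Fin n) :
    ∃ s : Metric.sphere (0 : EuclideanSpace ℝ (Fin n)) 1 → ZMod 2, (∀ x, s (-x) = s x + 1) ∧
      ∀ x y, s x ≠ s y → |x.1 i| ≤ |x.1 i - y.1 i| := by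
  classical
  let T : Metric.sphere (0 : EuclideanSpace ℝ (Fin n)) 1 → Lex (Fin n → ℝ) := fun x =>
    toLex (WithLp.ofLp x.1)
  have hT0 : ∀ x, T x ≠ 0 := fun x hx => by
    have : x.1 = 0 := by
      ext j
      exact congrFun hx j
    exact ne_zero_of_mem_unit_sphere x this
  have hTneg : ∀ x, 0 < T (-x) ↔ ¬ 0 < T x := fun x => by
    change 0 < -T x ↔ _
    rw [Left.neg_pos_iff]
    exact ⟨fun h => lt_asymm h, fun h => (lt_or_gt_of_ne (hT0 x)).resolve_right h⟩
  refine ⟨fun x => if 0 < x.1 i ∨ x.1 i = 0 ∧ 0 < T x then 1 else 0, fun x => ?_, fun x y h => ?_⟩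
  · have hneg : (-x).1 i = -x.1 i := rfl
    have h2 : (1 + 1 : ZMod 2) = 0 := by decide
    simp only [hneg, hTneg, Left.neg_pos_iff, neg_eq_zero]
    rcases lt_trichotomy (x.1 i) 0 with hi | hi | hi
    · simp [hi, hi.not_gt, hi.ne]
    · by_cases ht : 0 < T x <;> simp [hi, ht, h2]
    · simp [hi, hi.not_gt, hi.ne', h2]
  · rcases le_total 0 (x.1 i) with hx | hx <;> rcases le_total 0 (y.1 i) with hy | hy
    · rcases hx.eq_or_lt with hx | hx
      · simp [← hx]
      rcases hy.eq_or_lt with hy | hy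
      · simp [← hy]
      · simp [hx, hy] at h
    · rw [abs_of_nonneg hx, abs_of_nonneg (by linarith)]
      linarith
    · rw [abs_of_nonpos hx, abs_of_nonpos (by linarith)]
      linarith
    · rcases hx.eq_or_lt with hx | hx
      · simp [hx]
      rcases hy.eq_or_lt with hy | hy
      · simp [hy]
      · simp [hx.not_gt, hy.not_gt, hx.ne, hy.ne] at h

open ListChain in
theorem not_isAntipodalCell_of_mem_small (n : ℕ) {ε : ℝ} (hε : 4 * (n + 1) * ε ^ 2 ≤ 1)
    {c : ListChain (Metric.sphere (0 : EuclideanSpace ℝ (Fin (n + 1))) 1)}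
    (hc : c ∈ small _ (n + 2) ε) (k : ℕ) : ¬ IsAntipodalCell k c := by
  intro hcell
  choose s hsneg hs using exists_odd_sign (n + 1)
  have h1 := hcell.eval_signProd (s := fun i => s (Fin.ofNat (n + 1) i)) (fun i => hsneg _)
  have h0 : eval (signProd (fun i => s (Fin.ofNat (n + 1) i)) 0) c ∈
      (⊥ : Submodule (ZMod 2) (ZMod 2)) := by
    refine map_mem_of_mem_small _ _ (fun l hl hsmall => ?_) hc
    rw [eval_single, one_mul, Submodule.mem_bot]
    by_contra hne
    obtain ⟨z, hz⟩ : ∃ z, z ∈ l := List.exists_mem_of_length_pos (by omega)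
    have hcoord : ∀ a ∈ l, ∀ b ∈ l, ∀ j, |a.1 j - b.1 j| < ε := fun a ha b hb j => by
      refine lt_of_le_of_lt ?_ (hsmall a ha b hb)
      rw [Subtype.dist_eq, dist_eq_norm]
      exact PiLp.norm_apply_le (a.1 - b.1) j
    have hzj : ∀ j, z.1 j ^ 2 < 4 * ε ^ 2 := fun j => by
      obtain ⟨a, ha, b, hb, hab⟩ := exists_ne_of_signProd_ne_zero hne (j := j) (by omega)
      rw [zero_add, Fin.ofNat_eq_cast, Fin.cast_val_eq_self] at hab
      have h1 := hs j a b hab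
      have h2 := hcoord a ha b hb j
      have h3 := hcoord z hz a ha j
      have h4 : |z.1 j| ≤ |z.1 j - a.1 j| + |a.1 j| := by
        simpa using abs_add_le (z.1 j - a.1 j) (a.1 j)
      have h5 : |z.1 j| < 2 * ε := by linarith
      rw [← sq_abs]
      nlinarith [abs_nonneg (z.1 j)]
    have hsum : ∑ j, z.1 j ^ 2 = 1 := by
      rw [← EuclideanSpace.real_norm_sq_eq, norm_eq_of_mem_sphere, one_pow]
    have hlt : ∑ j, z.1 j ^ 2 < ∑ _j : Fin (n + 1), 4 * ε ^ 2 :=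
      Finset.sum_lt_sum_of_nonempty Finset.univ_nonempty fun j _ => hzj j
    simp only [Finset.sum_const, Finset.card_univ, Fintype.card_fin, nsmul_eq_mul] at hlt
    push_cast at hlt
    linarith
  rw [Submodule.mem_bot, h1] at h0
  exact one_ne_zero h0

end EuclideanSpace

open ListChain in
/-- No continuous odd selfmap of a sphere is nullhomotopic. -/
theorem odd_selfmap_not_nullhomotopic (n : ℕ)
    (f : C((Metric.sphere (0 : EuclideanSpace ℝ (Fin (n + 1))) 1),
      (Metric.sphere (0 : EuclideanSpace ℝ (Fin (n + 1))) 1)))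
    (hodd : ∀ x : (Metric.sphere (0 : EuclideanSpace ℝ (Fin (n + 1))) 1), f (-x) = -f x) :
    ¬ f.Nullhomotopic := by
  rintro ⟨p, ⟨H⟩⟩
  have hε : (0 : ℝ) < 1 / (2 * (n + 1)) := by positivity
  obtain ⟨δ, hδ, h⟩ := exists_boundary_eq_of_homotopy H.continuous (p := p)
    (fun x => H.apply_one x) hε
  obtain ⟨b, hb, hbcell⟩ := EuclideanSpace.exists_small_isAntipodalCell n hδ
  obtain ⟨c, hc, hbc⟩ := h _ _
    (add_mem hb (push_mem_small (fun x y hxy => by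
      rwa [Subtype.dist_eq, coe_neg_sphere, coe_neg_sphere, dist_neg_neg]) hb))
    hbcell.boundary_add
  refine EuclideanSpace.not_isAntipodalCell_of_mem_small n ?_ hc (n + 1)
    ⟨_, hbcell.push hodd, ?_⟩
  · have hn : (0 : ℝ) ≤ n := Nat.cast_nonneg n
    rw [div_pow, one_pow, mul_one_div, div_le_one (by positivity)]
    nlinarith
  · have hH : (fun x => H (0, x)) = f := funext fun x => H.apply_zero x
    rw [hbc, hH, map_add, push_push, push_push]
    congr 3
    funext x
    exact hodd x
end

section
/- For all natural numbers n and N there exists a continuous odd map F : S^{n+1} → S^N if and only if there exists a continuous odd map f : S^n → S^N that is nullhomotopic (homotopic to a constant map). -/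
/-- The map `S^n × [-1, 1] → S^{n+1}`, `(x, t) ↦ (t, √(1 - t²) x)`, which collapses
`S^n × {1}` and `S^n × {-1}` to the two poles. -/
noncomputable def sphereSuspensionMap (n : ℕ) :
    C(Metric.sphere (0 : EuclideanSpace ℝ (Fin (n + 1))) 1 × Set.Icc (-1 : ℝ) 1,
      Metric.sphere (0 : EuclideanSpace ℝ (Fin (n + 2))) 1) where
  toFun p := ⟨WithLp.toLp 2 (Matrix.vecCons (p.2 : ℝ)
      (fun i => √(1 - (p.2 : ℝ) ^ 2) * (p.1 : EuclideanSpace ℝ (Fin (n + 1))) i)), by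
    obtain ⟨⟨x, hx⟩, t, ht⟩ := p
    have hx' : ∑ i, x i ^ 2 = 1 := by
      rw [← EuclideanSpace.real_norm_sq_eq, mem_sphere_zero_iff_norm.1 hx, one_pow]
    have ht' : 0 ≤ 1 - t ^ 2 := by nlinarith [ht.1, ht.2]
    rw [mem_sphere_zero_iff_norm, ← sq_eq_sq₀ (norm_nonneg _) zero_le_one,
      EuclideanSpace.real_norm_sq_eq, Fin.sum_univ_succ]
    simp [mul_pow, ← Finset.mul_sum, hx', Real.sq_sqrt ht']⟩
  continuous_toFun := by
    refine Continuous.subtype_mk ((PiLp.continuous_toLp 2 _).comp ?_) _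
    refine Continuous.matrixVecCons (by fun_prop) (by fun_prop)

section sphereSuspensionMap

variable {n : ℕ} (x : Metric.sphere (0 : EuclideanSpace ℝ (Fin (n + 1))) 1)
  (t : Set.Icc (-1 : ℝ) 1)

theorem sphereSuspensionMap_apply_zero :
    (sphereSuspensionMap n (x, t) : EuclideanSpace ℝ (Fin (n + 2))) 0 = t := rfl

theorem sphereSuspensionMap_apply_succ (i : Fin (n + 1)) :
    (sphereSuspensionMap n (x, t) : EuclideanSpace ℝ (Fin (n + 2))) i.succ =
      √(1 - (t : ℝ) ^ 2) * (x : EuclideanSpace ℝ (Fin (n + 1))) i := rfl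

theorem sphereSuspensionMap_neg {s : Set.Icc (-1 : ℝ) 1} (hs : (s : ℝ) = -t) :
    sphereSuspensionMap n (-x, s) = -sphereSuspensionMap n (x, t) := by
  ext i
  refine Fin.cases ?_ (fun i => ?_) i
  · simpa [sphereSuspensionMap_apply_zero] using hs
  · simp [sphereSuspensionMap_apply_succ, hs]

theorem sphereSuspensionMap_eq_of_sq_eq_one
    (y : Metric.sphere (0 : EuclideanSpace ℝ (Fin (n + 1))) 1)
    (ht : (t : ℝ) ^ 2 = 1) : sphereSuspensionMap n (x, t) = sphereSuspensionMap n (y, t) := by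
  ext i
  refine Fin.cases rfl (fun i => ?_) i
  simp [sphereSuspensionMap_apply_succ, ht]

end sphereSuspensionMap

theorem eq_of_sphereSuspensionMap_eq {n : ℕ}
    {p q : Metric.sphere (0 : EuclideanSpace ℝ (Fin (n + 1))) 1 × Set.Icc (-1 : ℝ) 1}
    (h : sphereSuspensionMap n p = sphereSuspensionMap n q) :
    p.2 = q.2 ∧ ((p.2 : ℝ) ^ 2 ≠ 1 → p.1 = q.1) := by
  obtain ⟨x, t⟩ := p
  obtain ⟨y, s⟩ := q
  have h' (i : Fin (n + 2)) := congrArg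
    (fun z : Metric.sphere (0 : EuclideanSpace ℝ (Fin (n + 2))) 1 =>
      (z : EuclideanSpace ℝ (Fin (n + 2))) i) h
  obtain rfl : t = s := Subtype.ext (h' 0)
  refine ⟨rfl, fun ht => ?_⟩
  have hpos : 0 < 1 - (t : ℝ) ^ 2 := by
    refine lt_of_le_of_ne ?_ fun h => ht (by linarith)
    nlinarith [t.2.1, t.2.2]
  ext i
  exact mul_left_cancel₀ (Real.sqrt_pos.2 hpos).ne' (h' i.succ)

theorem sphereSuspensionMap_surjective (n : ℕ) : Function.Surjective (sphereSuspensionMap n) := by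
  rintro ⟨z, hz⟩
  let y : EuclideanSpace ℝ (Fin (n + 1)) := WithLp.toLp 2 fun i => z i.succ
  have hzy : z 0 ^ 2 + ‖y‖ ^ 2 = 1 := by
    have hnorm : ‖z‖ ^ 2 = 1 := by rw [mem_sphere_zero_iff_norm.1 hz, one_pow]
    rw [EuclideanSpace.real_norm_sq_eq, Fin.sum_univ_succ] at hnorm
    rwa [EuclideanSpace.real_norm_sq_eq]
  have hsqrt : √(1 - z 0 ^ 2) = ‖y‖ := by
    rw [← hzy, add_sub_cancel_left, Real.sqrt_sq (norm_nonneg _)]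
  have hz0 : z 0 ∈ Set.Icc (-1 : ℝ) 1 := abs_le.1 (abs_le_one_iff_mul_self_le_one.2 (by nlinarith))
  obtain ⟨x, hx⟩ : ∃ x : Metric.sphere (0 : EuclideanSpace ℝ (Fin (n + 1))) 1,
      ‖y‖ • (x : EuclideanSpace ℝ (Fin (n + 1))) = y := by
    rcases eq_or_ne y 0 with h0 | h0
    · obtain ⟨x, hx⟩ := NormedSpace.sphere_nonempty (E := EuclideanSpace ℝ (Fin (n + 1)))
        (x := 0) (r := 1) |>.2 zero_le_one
      exact ⟨⟨x, hx⟩, by simp [h0]⟩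
    · refine ⟨⟨‖y‖⁻¹ • y, ?_⟩, smul_inv_smul₀ (norm_ne_zero_iff.2 h0) y⟩
      simp [norm_smul, h0]
  refine ⟨(x, ⟨z 0, hz0⟩), ?_⟩
  ext i
  refine Fin.cases rfl (fun i => ?_) i
  rw [sphereSuspensionMap_apply_succ, hsqrt]
  exact congrArg (fun v : EuclideanSpace ℝ (Fin (n + 1)) => v i) hx

theorem isQuotientMap_sphereSuspensionMap (n : ℕ) :
    Topology.IsQuotientMap (sphereSuspensionMap n) :=
  (sphereSuspensionMap n).continuous.isClosedMap.isQuotientMap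
    (sphereSuspensionMap n).continuous (sphereSuspensionMap_surjective n)

/-- Restricting an odd map on `S^{n+1}` to the equator gives a nullhomotopic odd map. -/
theorem exists_nullhomotopic_odd_map_of_odd_map {n : ℕ} {Y : Type*} [TopologicalSpace Y] [Neg Y]
    (F : C(Metric.sphere (0 : EuclideanSpace ℝ (Fin (n + 2))) 1, Y)) (hF : ∀ x, F (-x) = -F x) :
    ∃ f : C(Metric.sphere (0 : EuclideanSpace ℝ (Fin (n + 1))) 1, Y),
      (∀ x, f (-x) = -f x) ∧ f.Nullhomotopic := by
  let j : C(unitInterval, Set.Icc (-1 : ℝ) 1) :=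
    ⟨Set.inclusion (Set.Icc_subset_Icc_left (by norm_num)), continuous_inclusion _⟩
  let G : C(unitInterval × Metric.sphere (0 : EuclideanSpace ℝ (Fin (n + 1))) 1, Y) :=
    (F.comp (sphereSuspensionMap n)).comp ⟨fun p => (p.2, j p.1), by fun_prop⟩
  obtain ⟨x₀, hx₀⟩ := NormedSpace.sphere_nonempty (E := EuclideanSpace ℝ (Fin (n + 1)))
    (x := 0) (r := 1) |>.2 zero_le_one
  refine ⟨G.curry 0, fun x => ?_, G (1, ⟨x₀, hx₀⟩), ⟨⟨G, fun x => rfl, fun x => ?_⟩⟩⟩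
  · change F (sphereSuspensionMap n (-x, j 0)) = -F (sphereSuspensionMap n (x, j 0))
    rw [sphereSuspensionMap_neg x (j 0) (by simp [j]), hF]
  · exact congrArg F (sphereSuspensionMap_eq_of_sq_eq_one _ _ _ (by simp [j]))

/-- A nullhomotopy of an odd map on `S^n` extends it to an odd map on `S^{n+1}`. -/
theorem exists_odd_map_of_nullhomotopic_odd_map {n : ℕ} {Y : Type*} [TopologicalSpace Y]
    [InvolutiveNeg Y] [ContinuousNeg Y]
    (f : C(Metric.sphere (0 : EuclideanSpace ℝ (Fin (n + 1))) 1, Y)) (hf : ∀ x, f (-x) = -f x)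
    (hnull : f.Nullhomotopic) :
    ∃ F : C(Metric.sphere (0 : EuclideanSpace ℝ (Fin (n + 2))) 1, Y), ∀ x, F (-x) = -F x := by
  obtain ⟨c, ⟨H⟩⟩ := hnull
  let π : ℝ → unitInterval := Set.projIcc 0 1 zero_le_one
  have hπ : Continuous π := continuous_projIcc
  have hπ0 : π 0 = 0 := Set.projIcc_left zero_le_one
  have hπ1 : π 1 = 1 := Set.projIcc_right zero_le_one
  let K : C(Metric.sphere (0 : EuclideanSpace ℝ (Fin (n + 1))) 1 × Set.Icc (-1 : ℝ) 1, Y) :=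
    { toFun := fun p => if 0 ≤ (p.2 : ℝ) then H (π p.2, p.1) else -H (π (-p.2), -p.1)
      continuous_toFun := by
        refine Continuous.if_le (by fun_prop) (by fun_prop) (by fun_prop) (by fun_prop) ?_
        intro p hp
        simp [← hp, hπ0, hf] }
  have hK : ∀ p, K p = if 0 ≤ (p.2 : ℝ) then H (π p.2, p.1) else -H (π (-p.2), -p.1) :=
    fun _ => rfl
  have hfac : ∀ p q, sphereSuspensionMap n p = sphereSuspensionMap n q → K p = K q := by
    rintro ⟨x, t⟩ ⟨y, s⟩ h
    obtain ⟨rfl, hxy⟩ := eq_of_sphereSuspensionMap_eq h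
    by_cases ht : (t : ℝ) ^ 2 = 1
    · rcases mul_self_eq_one_iff.1 ((sq _).symm.trans ht) with h1 | h1 <;>
        simp [hK, h1, hπ1, zero_lt_one.not_ge]
    · obtain rfl := hxy ht
      rfl
  refine ⟨(isQuotientMap_sphereSuspensionMap n).lift K hfac, fun z => ?_⟩
  obtain ⟨⟨x, t⟩, rfl⟩ := sphereSuspensionMap_surjective n z
  have hlift (p) : (isQuotientMap_sphereSuspensionMap n).lift K hfac (sphereSuspensionMap n p) =
      K p := DFunLike.congr_fun ((isQuotientMap_sphereSuspensionMap n).lift_comp K hfac) p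
  let s : Set.Icc (-1 : ℝ) 1 := ⟨-t, neg_le_neg t.2.2, neg_le.1 t.2.1⟩
  have hs : (s : ℝ) = -t := rfl
  rw [← sphereSuspensionMap_neg x t hs, hlift, hlift, hK, hK]
  rcases lt_trichotomy (t : ℝ) 0 with h | h | h
  · simp [hs, h.le, h.not_ge]
  · simp [hs, h, hπ0, hf]
  · simp [hs, h.le, h.not_ge]


/-- There exists a continuous odd map `S^{n+1} → S^N` if and only if there exists a
continuous odd map `S^n → S^N` that is nullhomotopic. -/
theorem exists_odd_map_succ_iff_exists_nullhomotopic_odd_map (n N : ℕ) :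
    (∃ F : C((Metric.sphere (0 : EuclideanSpace ℝ (Fin (n + 2))) 1),
        (Metric.sphere (0 : EuclideanSpace ℝ (Fin (N + 1))) 1)),
      ∀ x, F (-x) = -F x) ↔
    (∃ f : C((Metric.sphere (0 : EuclideanSpace ℝ (Fin (n + 1))) 1),
        (Metric.sphere (0 : EuclideanSpace ℝ (Fin (N + 1))) 1)),
      (∀ x, f (-x) = -f x) ∧ f.Nullhomotopic) :=
  ⟨fun ⟨F, hF⟩ => exists_nullhomotopic_odd_map_of_odd_map F hF,
    fun ⟨f, hf, hnull⟩ => exists_odd_map_of_nullhomotopic_odd_map f hf hnull⟩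
end

section
/- Let d ≥ 1. There exists a continuous map f : EuclideanSpace ℝ (Fin d) → EuclideanSpace ℝ (Fin d) with f(x) ≠ 0 for every x in the closed unit ball Metric.closedBall 0 1 and with f(-x) = -f(x) for every x on the unit sphere Metric.sphere 0 1, if and only if there exists a continuous map g : S^d → EuclideanSpace ℝ (Fin d) with g(x) ≠ 0 for all x and g(-x) = -g(x) for all x ∈ S^d. -/
/-- The squared Euclidean norm splits off the first coordinate. -/
theorem EuclideanSpace.norm_sq_eq_head_add_tail {d : ℕ} (x : EuclideanSpace ℝ (Fin (d + 1))) :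
    ‖x‖ ^ 2 = x 0 ^ 2 + ‖WithLp.toLp 2 fun i : Fin d => x i.succ‖ ^ 2 := by
  simp [EuclideanSpace.real_norm_sq_eq, Fin.sum_univ_succ]

/-- Gluing `f(y)` on the upper hemisphere with `-f(-y)` on the lower one turns a nonvanishing map
on the ball that is odd on the boundary into a nonvanishing odd map on the sphere. -/
theorem exists_nonvanishing_odd_on_sphere_of_ball {d : ℕ} {F : Type*} [NormedAddCommGroup F]
    {f : EuclideanSpace ℝ (Fin d) → F} (hf : Continuous f)
    (hf0 : ∀ x ∈ Metric.closedBall (0 : EuclideanSpace ℝ (Fin d)) 1, f x ≠ 0)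
    (hodd : ∀ x ∈ Metric.sphere (0 : EuclideanSpace ℝ (Fin d)) 1, f (-x) = -f x) :
    ∃ g : Metric.sphere (0 : EuclideanSpace ℝ (Fin (d + 1))) 1 → F,
      Continuous g ∧ (∀ x, g x ≠ 0) ∧ ∀ x, g (-x) = -g x := by
  let tail : Metric.sphere (0 : EuclideanSpace ℝ (Fin (d + 1))) 1 → EuclideanSpace ℝ (Fin d) :=
    fun x => WithLp.toLp 2 fun i => x.1 i.succ
  have tail_continuous : Continuous tail := by fun_prop
  have tail_neg (x) : tail (-x) = -tail x := by ext i; simp [tail]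
  have norm_sq (x : Metric.sphere (0 : EuclideanSpace ℝ (Fin (d + 1))) 1) :
      x.1 0 ^ 2 + ‖tail x‖ ^ 2 = 1 := by
    rw [← EuclideanSpace.norm_sq_eq_head_add_tail, norm_eq_of_mem_sphere, one_pow]
  have tail_mem_ball (x) : tail x ∈ Metric.closedBall 0 1 := by
    rw [mem_closedBall_zero_iff]
    nlinarith [norm_sq x, sq_nonneg (x.1 0)]
  have odd_of_head_eq_zero (x : Metric.sphere (0 : EuclideanSpace ℝ (Fin (d + 1))) 1)
      (hx : x.1 0 = 0) : f (-tail x) = -f (tail x) := by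
    refine hodd _ (mem_sphere_zero_iff_norm.2 ?_)
    have h := norm_sq x
    rw [hx] at h
    nlinarith [norm_nonneg (tail x)]
  refine ⟨fun x => if 0 ≤ x.1 0 then f (tail x) else -f (-tail x), ?_, fun x => ?_, fun x => ?_⟩
  · refine Continuous.if_le (by fun_prop) (by fun_prop) continuous_const (by fun_prop) ?_
    intro x hx
    rw [odd_of_head_eq_zero x hx.symm, neg_neg]
  · dsimp only
    split_ifs
    · exact hf0 _ (tail_mem_ball x)
    · exact neg_ne_zero.2 (tail_neg x ▸ hf0 _ (tail_mem_ball (-x)))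
  · have hneg : (-x).1 0 = -x.1 0 := rfl
    simp only [hneg, tail_neg, neg_neg, Left.nonneg_neg_iff]
    rcases lt_trichotomy (x.1 0) 0 with h | h | h
    · simp [h.le, h.not_ge]
    · simp [h, odd_of_head_eq_zero x h]
    · simp [h.le, h.not_ge]

/-- Pulling a nonvanishing odd map on the sphere back along
`y ↦ (max 0 (1 - ‖y‖), y) / ‖(max 0 (1 - ‖y‖), y)‖` gives a nonvanishing map that is odd on the
unit sphere of the equatorial hyperplane. -/
theorem exists_nonvanishing_odd_on_ball_of_sphere {d : ℕ} {F : Type*} [NormedAddCommGroup F]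
    {g : Metric.sphere (0 : EuclideanSpace ℝ (Fin (d + 1))) 1 → F} (hg : Continuous g)
    (hg0 : ∀ x, g x ≠ 0) (hodd : ∀ x, g (-x) = -g x) :
    ∃ f : EuclideanSpace ℝ (Fin d) → F, Continuous f ∧ (∀ x, f x ≠ 0) ∧
      ∀ x ∈ Metric.sphere (0 : EuclideanSpace ℝ (Fin d)) 1, f (-x) = -f x := by
  let lift : EuclideanSpace ℝ (Fin d) → EuclideanSpace ℝ (Fin (d + 1)) :=
    fun y => WithLp.toLp 2 (Fin.cons (max 0 (1 - ‖y‖)) y.ofLp)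
  have lift_continuous : Continuous lift :=
    (PiLp.continuous_toLp 2 _).comp (Continuous.finCons (by fun_prop) (by fun_prop))
  have lift_ne_zero (y) : lift y ≠ 0 := by
    intro h
    have hy : y = 0 := by
      ext i
      simpa [lift] using congrArg (fun v => v.ofLp i.succ) h
    simpa [lift, hy] using congrArg (fun v => v.ofLp 0) h
  have lift_neg {y} (hy : ‖y‖ = 1) : lift (-y) = -lift y := by
    ext i
    refine Fin.cases ?_ (fun j => ?_) i <;> simp [lift, hy]
  let proj : EuclideanSpace ℝ (Fin d) → Metric.sphere (0 : EuclideanSpace ℝ (Fin (d + 1))) 1 :=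
    fun y => ⟨‖lift y‖⁻¹ • lift y, by
      rw [mem_sphere_zero_iff_norm]; exact norm_smul_inv_norm (𝕜 := ℝ) (lift_ne_zero y)⟩
  have proj_continuous : Continuous proj :=
    ((lift_continuous.norm.inv₀ fun y => norm_ne_zero_iff.2 (lift_ne_zero y)).smul
      lift_continuous).subtype_mk _
  refine ⟨g ∘ proj, hg.comp proj_continuous, fun y => hg0 _, fun y hy => ?_⟩
  have proj_neg : proj (-y) = -proj y := by
    ext1
    simp [proj, lift_neg (mem_sphere_zero_iff_norm.1 hy)]
  simp only [Function.comp_apply, proj_neg, hodd]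

/-- There exists a continuous map `f : ℝ^d → ℝ^d` nonvanishing on the closed unit ball and
odd on the unit sphere, if and only if there exists a continuous nonvanishing odd map
`g : S^d → ℝ^d`. -/
theorem exists_nonvanishing_odd_on_ball_iff_sphere (d : ℕ) (hd : 1 ≤ d) :
    (∃ f : EuclideanSpace ℝ (Fin d) → EuclideanSpace ℝ (Fin d), Continuous f ∧
      (∀ x ∈ Metric.closedBall (0 : EuclideanSpace ℝ (Fin d)) 1, f x ≠ 0) ∧
      (∀ x ∈ Metric.sphere (0 : EuclideanSpace ℝ (Fin d)) 1, f (-x) = -f x)) ↔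
    (∃ g : (Metric.sphere (0 : EuclideanSpace ℝ (Fin (d + 1))) 1) → EuclideanSpace ℝ (Fin d),
      Continuous g ∧ (∀ x, g x ≠ 0) ∧
      (∀ x : (Metric.sphere (0 : EuclideanSpace ℝ (Fin (d + 1))) 1), g (-x) = -g x)) := by
  constructor
  · rintro ⟨f, hf, hf0, hodd⟩
    exact exists_nonvanishing_odd_on_sphere_of_ball hf hf0 hodd
  · rintro ⟨g, hg, hg0, hodd⟩
    obtain ⟨f, hf, hf0, hf_odd⟩ := exists_nonvanishing_odd_on_ball_of_sphere hg hg0 hodd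
    exact ⟨f, hf, fun x _ => hf0 x, hf_odd⟩
end
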